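/- arXiv:math/0610237 — 4 statements merged into one kernel-verified Lean document; each statement's English description precedes it below -/
import Mathlib

section
/- Fix k ≥ 2 and 1 ≤ r ≤ k. Let F_r(x) = Σ_{n≥0} a_n x^n where a_n is the number of Motzkin permutations of length n containing exactly r occurrences of the pattern 12…k (i.e., having exactly r increasing subsequences of length k). Then F_r(x)·q_{k−1}(x)^{r+1} = x^{2k+r−3}·(q_{k−2}(x) − x²·q_{k−3}(x))^{r−1}. Equivalently, F_r(x) = (U_{k−2}(s) − x U_{k−3}(s))^{r−1} / U_{k−1}(s)^{r+1} with s = (1−x)/(2x). -/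
/-- `π` avoids the classical pattern 132. -/
def Avoids132 {n : ℕ} (π : Equiv.Perm (Fin n)) : Prop :=
  ¬ ∃ i j k : Fin n, i < j ∧ j < k ∧ π i < π k ∧ π k < π j

/-- `π` avoids the generalized pattern 1-23. -/
def Avoids1_23 {n : ℕ} (π : Equiv.Perm (Fin n)) : Prop :=
  ¬ ∃ (a b : Fin n) (h : (b : ℕ) + 1 < n), a < b ∧ π a < π b ∧ π b < π ⟨(b : ℕ) + 1, h⟩

/-- A Motzkin permutation avoids both 132 and 1-23. -/
def IsMotzkinPerm {n : ℕ} (π : Equiv.Perm (Fin n)) : Prop :=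
  Avoids132 π ∧ Avoids1_23 π

/-- `nIncr j π` is the number of occurrences of the pattern `12…j` in `π`, i.e. the
number of increasing subsequences of length `j`. -/
noncomputable def nIncr (j : ℕ) {n : ℕ} (π : Equiv.Perm (Fin n)) : ℕ :=
  Nat.card {f : Fin j → Fin n // StrictMono f ∧ StrictMono fun i => π (f i)}

/-- `qcheb r` is the polynomial `q_{r-1}`, where `q_{-1} = 0`, `q_0 = 1` and
`q_{r+1} = (1-x) q_r - x² q_{r-1}`; equivalently `q_r(x) = x^r U_r((1-x)/(2x))`. -/
noncomputable def qcheb : ℕ → PowerSeries ℚ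
  | 0 => 0
  | 1 => 1
  | (r + 2) => (1 - PowerSeries.X) * qcheb (r + 1) - PowerSeries.X ^ 2 * qcheb r


namespace MotzAux

def cond (u : List ℕ) (b : ℕ) (w : List ℕ) : Prop :=
  ∀ a ∈ u, (∀ c ∈ w, ¬ (a < c ∧ c < b)) ∧ (∀ c ∈ w.head?, ¬ (a < b ∧ b < c))

def Mz : List ℕ → List ℕ → List ℕ → Prop
  | _, [], _ => True
  | p, (b :: w), q => cond p b (w ++ q) ∧ Mz (p ++ [b]) w q

theorem Mz_append (l₁ : List ℕ) : ∀ (p l₂ q : List ℕ),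
    Mz p (l₁ ++ l₂) q ↔ Mz p l₁ (l₂ ++ q) ∧ Mz (p ++ l₁) l₂ q := by
  induction l₁ with
  | nil => intro p l₂ q; simp [Mz]
  | cons b w ih =>
    intro p l₂ q
    simp [Mz, ih, and_assoc]

theorem Mz_suf (l : List ℕ) : ∀ (p q : List ℕ),
    (∀ a ∈ p ++ l, ∀ b ∈ p ++ l, ∀ c ∈ q, ¬ (a < c ∧ c < b)) →
    (∀ b ∈ p ++ l, ∀ c ∈ q.head?, c ≤ b) → (Mz p l q ↔ Mz p l []) := by
  induction l with
  | nil => intro p q _ _; simp [Mz]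
  | cons b w ih =>
    intro p q h1 h2
    have e : p ++ [b] ++ w = p ++ b :: w := by simp
    rw [Mz, Mz, ih (p ++ [b]) q (by rw [e]; exact h1) (by rw [e]; exact h2)]
    refine and_congr_left fun _ => ?_
    constructor
    · intro h a ha
      refine ⟨fun c hc => (h a ha).1 c (by simp at hc ⊢; tauto), fun c hc => (h a ha).2 c ?_⟩
      cases w <;> simp_all
    · intro h a ha
      refine ⟨fun c hc => ?_, fun c hc => ?_⟩
      · rcases List.mem_append.1 hc with hc | hc
        · exact (h a ha).1 c (by simpa using hc)
        · exact h1 a (by simp [ha]) b (by simp) c hc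
      · cases w with
        | nil =>
          have := h2 b (by simp) c (by simpa using hc)
          omega
        | cons x w => exact (h a ha).2 c (by simpa using hc)

theorem Mz_pre (l : List ℕ) : ∀ (p p' q : List ℕ),
    (∀ a ∈ p, ∀ c ∈ l ++ q, c < a) → (Mz (p ++ p') l q ↔ Mz p' l q) := by
  induction l with
  | nil => intro p p' q _; simp [Mz]
  | cons b w ih =>
    intro p p' q h
    rw [Mz, Mz, List.append_assoc, ih p (p' ++ [b]) q (fun a ha c hc => h a ha c (by simp at hc ⊢; tauto))]
    refine and_congr_left fun _ => ?_
    constructor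
    · intro h' a ha
      exact h' a (by simp [ha])
    · intro h' a ha
      rcases List.mem_append.1 ha with ha | ha
      · have hb := h a ha b (by simp)
        refine ⟨fun c hc => ?_, fun c hc => by omega⟩
        have := h a ha c (by simp at hc ⊢; tauto)
        omega
      · exact h' a ha

theorem Mz_map (f : ℕ → ℕ) (hf : StrictMono f) (l : List ℕ) : ∀ (p q : List ℕ),
    Mz (p.map f) (l.map f) (q.map f) ↔ Mz p l q := by
  induction l with
  | nil => intro p q; simp [Mz]
  | cons b w ih =>
    intro p q
    have := ih (p ++ [b]) q
    simp only [List.map_append, List.map_cons, List.map_nil] at this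
    rw [List.map_cons, Mz, Mz, this]
    refine and_congr_left fun _ => ?_
    rw [← List.map_append]
    simp only [cond, List.head?_map, List.forall_mem_map, hf.lt_iff_lt]
    refine forall₂_congr fun a _ => and_congr_right fun _ => ?_
    cases (w ++ q).head? <;> simp [hf.le_iff_le]

theorem Mz_lev (M : ℕ) (t : List ℕ) (h : ∀ x ∈ t, x < M) :
    Mz [] (M :: t) [] ↔ Mz [] t [] := by
  have := Mz_pre t [M] [] [] (by simpa using h)
  simp only [List.append_nil] at this
  simp [Mz, this, cond]

theorem Mz_up (s t : List ℕ) (m M : ℕ) (hsM : ∀ x ∈ s, x < M) (hms : ∀ x ∈ s, m < x)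
    (htm : ∀ x ∈ t, x < m) (hmM : m < M) :
    Mz [] (s ++ m :: M :: t) [] ↔ Mz [] s [] ∧ Mz [] t [] := by
  have hpre := Mz_pre t (s ++ [m, M]) [] [] (by
    intro a ha c hc
    simp at ha hc
    have := htm c hc
    rcases ha with ha | rfl | rfl
    · have := hms a ha; omega
    · omega
    · omega)
  have hsuf := Mz_suf s [] (m :: M :: t) (by
    intro a ha b hb c hc
    simp at ha hb hc
    have := hms a ha
    have := hms b hb
    have := hsM b hb
    rcases hc with rfl | rfl | hc
    · omega
    · omega
    · have := htm c hc; omega) (by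
    intro b hb c hc
    simp at hb hc
    have := hms b hb
    omega)
  rw [Mz_append]
  simp only [List.append_nil, List.nil_append] at hpre ⊢
  rw [hsuf, Mz, Mz]
  simp only [List.append_assoc, List.cons_append, List.nil_append, List.append_nil]
  rw [hpre]
  have c1 : cond s m (M :: t) := by
    intro a ha
    have := hms a ha
    refine ⟨fun c hc => ?_, fun c hc => by omega⟩
    simp at hc
    rcases hc with rfl | hc
    · omega
    · have := htm c hc; omega
  have c2 : cond (s ++ [m]) M t := by
    intro a ha
    have hma : m ≤ a := by
      simp at ha
      rcases ha with ha | rfl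
      · exact (hms a ha).le
      · rfl
    refine ⟨fun c hc => ?_, fun c hc => ?_⟩
    · have := htm c hc; omega
    · have := htm c (List.mem_of_mem_head? hc); omega
  tauto

theorem Mz_iff (l : List ℕ) : ∀ (p q : List ℕ),
    Mz p l q ↔ ∀ i (h : i < l.length), cond (p ++ l.take i) l[i] (l.drop (i+1) ++ q) := by
  induction l with
  | nil => intro p q; simp [Mz]
  | cons b w ih =>
    intro p q
    rw [Mz, ih]
    constructor
    · rintro ⟨h1, h2⟩ i hi
      cases i with
      | zero => simpa using h1
      | succ i => simpa using h2 i (by simpa using hi)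
    · intro h
      refine ⟨by have := h 0 (by simp); simpa only [List.take_zero, List.append_nil, List.getElem_cons_zero, List.drop_succ_cons, List.drop_zero] using this, fun i hi => ?_⟩
      have := h (i+1) (by simpa using hi)
      simpa only [List.take_succ_cons, List.getElem_cons_succ, List.drop_succ_cons, List.append_assoc, List.singleton_append] using this

/-- counting increasing sublists -/
def inc : ℕ → ℕ → List ℕ → ℕ
  | 0, _, _ => 1
  | _ + 1, _, [] => 0
  | j + 1, a, b :: l => inc (j + 1) a l + if a ≤ b then inc j (b + 1) l else 0

theorem inc_append_small (s : List ℕ) : ∀ (j a : ℕ) (t : List ℕ), (∀ x ∈ t, x < a) →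
    inc j a (s ++ t) = inc j a s := by
  induction s with
  | nil =>
    intro j a t h
    cases j with
    | zero => simp [inc]
    | succ j =>
      induction t with
      | nil => rfl
      | cons x t ih =>
        have := h x (by simp)
        have ih' := ih (fun y hy => h y (by simp [hy]))
        simp only [List.nil_append] at ih' ⊢
        rw [inc.eq_3, ih', if_neg (by omega), add_zero]
  | cons b s ih =>
    intro j a t h
    cases j with
    | zero => simp [inc]
    | succ j =>
      rw [List.cons_append, inc, inc, ih _ _ _ h]
      split_ifs with hab
      · rw [ih _ _ _ (fun x hx => by have := h x hx; omega)]
      · rfl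

theorem inc_append (s : List ℕ) : ∀ (j : ℕ) (t : List ℕ), (∀ y ∈ s, ∀ x ∈ t, x < y) →
    inc (j+1) 0 (s ++ t) = inc (j+1) 0 s + inc (j+1) 0 t := by
  induction s with
  | nil => intro j t h; simp [inc]
  | cons b s ih =>
    intro j t h
    rw [List.cons_append, inc, inc, ih j t (fun y hy => h y (by simp [hy])),
      inc_append_small s j (b+1) t (fun x hx => by have := h b (by simp) x hx; omega)]
    simp; ring

theorem inc_concat_max (s : List ℕ) : ∀ (j a M : ℕ), a ≤ M → (∀ x ∈ s, x < M) →
    inc (j+1) a (s ++ [M]) = inc (j+1) a s + inc j a s := by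
  induction s with
  | nil =>
    intro j a M h _
    simp only [List.nil_append, inc, if_pos h]
    cases j <;> simp [inc]
  | cons b s ih =>
    intro j a M h hs
    have hb := hs b (by simp)
    have hs' : ∀ x ∈ s, x < M := fun y hy => hs y (by simp [hy])
    rw [List.cons_append, inc, inc, ih j a M h hs']
    cases j with
    | zero => simp [inc]; split_ifs <;> omega
    | succ j =>
      rw [inc]
      split_ifs with hab
      · rw [ih j (b+1) M hb hs']; omega
      · omega

theorem inc_map (c : ℕ) (s : List ℕ) : ∀ (j a : ℕ), inc j (a + c) (s.map (· + c)) = inc j a s := by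
  induction s with
  | nil => intro j a; cases j <;> simp [inc]
  | cons b s ih =>
    intro j a
    cases j with
    | zero => simp [inc]
    | succ j =>
      rw [List.map_cons, inc, inc, ih, show b + c + 1 = (b+1) + c by ring, ih]
      simp

theorem inc_low (s : List ℕ) (j : ℕ) (a : ℕ) (h : ∀ x ∈ s, a ≤ x) : inc j a s = inc j 0 s := by
  induction s generalizing j with
  | nil => cases j <;> simp [inc]
  | cons b s ih =>
    cases j with
    | zero => simp [inc]
    | succ j =>
      rw [inc, inc, ih _ (fun x hx => h x (by simp [hx])), if_pos (h b (by simp))]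
      simp

inductive T where
  | leaf : T
  | lev : T → T
  | up : T → T → T

def T.size : T → ℕ
  | .leaf => 0
  | .lev t => t.size + 1
  | .up s t => s.size + t.size + 2

def T.w : T → List ℕ
  | .leaf => []
  | .lev t => t.size :: t.w
  | .up s t => s.w.map (· + (t.size + 1)) ++ t.size :: (s.size + t.size + 1) :: t.w

theorem T.w_lt (t : T) : ∀ x ∈ t.w, x < t.size := by
  induction t with
  | leaf => simp [w]
  | lev t ih =>
    intro x hx
    simp [w, size] at hx ⊢
    rcases hx with rfl | hx
    · omega
    · have := ih x hx; omega
  | up s t ihs iht =>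
    intro x hx
    simp [w, size] at hx ⊢
    rcases hx with ⟨y, hy, rfl⟩ | rfl | rfl | hx
    · have := ihs y hy; omega
    · omega
    · omega
    · have := iht x hx; omega

theorem T.w_perm (t : T) : t.w.Perm (List.range t.size) := by
  induction t with
  | leaf => simp [w, size]
  | lev t ih =>
    rw [w, size, List.range_succ]
    exact (ih.cons _).trans (List.perm_append_singleton _ _).symm
  | up s t ihs iht =>
    rw [w, size, show s.size + t.size + 2 = (t.size + 1 + s.size) + 1 by ring, List.range_succ,
      List.range_add, List.range_succ]
    have h1 := ihs.map (· + (t.size + 1))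
    have e : List.map (fun x => t.size + 1 + x) (List.range s.size) =
      List.map (· + (t.size + 1)) (List.range s.size) := by
      congr 1; funext x; ring
    rw [e, show s.size + t.size + 1 = t.size + 1 + s.size by ring]
    refine (h1.append ((iht.cons _).cons _)).trans ?_
    rw [List.perm_iff_count]
    intro x
    simp only [List.count_append, List.count_cons, List.count_nil]
    omega

theorem T.w_Mz (t : T) : Mz [] t.w [] := by
  induction t with
  | leaf => simp [w, Mz]
  | lev t ih => rw [w, Mz_lev _ _ t.w_lt]; exact ih
  | up s t ihs iht =>
    rw [w, Mz_up]
    · refine ⟨?_, iht⟩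
      have := (Mz_map (· + (t.size + 1)) (fun a b h => by simpa using h) s.w [] []).2 ihs
      simpa using this
    · intro x hx
      simp at hx
      obtain ⟨y, hy, rfl⟩ := hx
      have := s.w_lt y hy
      omega
    · intro x hx
      simp at hx
      obtain ⟨y, hy, rfl⟩ := hx
      omega
    · exact t.w_lt
    · omega

theorem T.size_eq (t : T) : t.w.length = t.size := by simpa using t.w_perm.length_eq

theorem app_inj (a : ℕ) (x₁ : List ℕ) : ∀ (x₂ y₁ y₂ : List ℕ), a ∉ x₁ → a ∉ x₂ →
    x₁ ++ a :: y₁ = x₂ ++ a :: y₂ → x₁ = x₂ ∧ y₁ = y₂ := by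
  induction x₁ with
  | nil =>
    intro x₂ y₁ y₂ _ h2 h
    cases x₂ with
    | nil => simpa using h
    | cons b x₂ => simp at h h2; exact absurd h.1 h2.1
  | cons c x₁ ih =>
    intro x₂ y₁ y₂ h1 h2 h
    cases x₂ with
    | nil => simp at h h1; exact absurd h.1.symm h1.1
    | cons b x₂ =>
      simp at h h1 h2
      have := ih x₂ y₁ y₂ h1.2 h2.2 h.2
      simp [h.1, this]

theorem T.w_inj : Function.Injective T.w := by
  intro t
  induction t with
  | leaf => intro t' h; cases t' <;> simp [w] at h; rfl
  | lev t ih =>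
    intro t' h
    have hl := congrArg List.length h
    rw [T.size_eq, T.size_eq] at hl
    cases t' with
    | leaf => simp [w] at h
    | lev t' => simp [w] at h; rw [ih h.2]
    | up s' t' =>
      exfalso
      simp only [w, size] at h hl
      have e : s'.size + t'.size + 1 = t.size := by omega
      rw [e] at h
      cases hs : s'.w with
      | nil => simp [hs] at h; omega
      | cons x l =>
        simp [hs] at h
        have := s'.w_lt x (by simp [hs])
        omega
  | up s t ihs iht =>
    intro t' h
    have hl := congrArg List.length h
    rw [T.size_eq, T.size_eq] at hl
    cases t' with
    | leaf => simp [w] at h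
    | lev t' =>
      exfalso
      simp only [w, size] at h hl
      have e : s.size + t.size + 1 = t'.size := by omega
      rw [e] at h
      cases hs : s.w with
      | nil => simp [hs] at h; omega
      | cons x l =>
        simp [hs] at h
        have := s.w_lt x (by simp [hs])
        omega
    | up s' t' =>
      simp only [w, size] at h hl
      have e : s'.size + t'.size + 1 = s.size + t.size + 1 := by omega
      rw [e] at h
      have key : ∀ (a b : T), a.size + b.size + 1 = s.size + t.size + 1 →
          s.size + t.size + 1 ∉ a.w.map (· + (b.size + 1)) ++ [b.size] := by
        intro a b hab hm
        simp at hm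
        rcases hm with ⟨y, hy, hy'⟩ | hm
        · have := a.w_lt y hy
          omega
        · omega
      have k1 := key s t rfl
      have k2 := key s' t' e
      have h' : (s.w.map (· + (t.size + 1)) ++ [t.size]) ++ (s.size + t.size + 1) :: t.w
        = (s'.w.map (· + (t'.size + 1)) ++ [t'.size]) ++ (s.size + t.size + 1) :: t'.w := by
        simpa using h
      obtain ⟨h1, h2⟩ := app_inj _ _ _ _ _ k1 k2 h'
      have ht := iht h2
      subst ht
      have h3 := List.append_cancel_right h1
      have h4 := List.map_injective_iff.2 (add_left_injective (t.size + 1)) h3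
      rw [ihs h4]

theorem split_range (l₁ l₂ : List ℕ) (n : ℕ) (h : (l₁ ++ l₂).Perm (List.range n))
    (hlt : ∀ y ∈ l₁, ∀ x ∈ l₂, x < y) :
    l₂.Perm (List.range l₂.length) ∧ l₁.Perm ((List.range l₁.length).map (l₂.length + ·)) := by
  have p1 := List.mergeSort_perm l₁ (fun a b => decide (a ≤ b))
  have p2 := List.mergeSort_perm l₂ (fun a b => decide (a ≤ b))
  have s1 := List.pairwise_mergeSort' (· ≤ ·) l₁
  have s2 := List.pairwise_mergeSort' (· ≤ ·) l₂
  have hn : n = l₂.length + l₁.length := by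
    have := h.length_eq
    simp at this; omega
  set m1 := l₁.mergeSort (fun a b => decide (a ≤ b))
  set m2 := l₂.mergeSort (fun a b => decide (a ≤ b))
  have hs : (m2 ++ m1).Pairwise (· ≤ ·) := by
    rw [List.pairwise_append]
    refine ⟨s2, s1, fun x hx y hy => (hlt y (p1.mem_iff.1 hy) x (p2.mem_iff.1 hx)).le⟩
  have hp : (m2 ++ m1).Perm (List.range n) :=
    (p2.append p1).trans (List.perm_append_comm.trans h)
  have e : m2 ++ m1 = List.range n :=
    hp.eq_of_pairwise (fun a b _ _ h1 h2 => le_antisymm h1 h2) hs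
      (List.pairwise_lt_range.imp fun h => le_of_lt h)
  rw [hn, List.range_add] at e
  have := List.append_inj e (by simpa using p2.length_eq)
  rw [← this.1, ← this.2]
  exact ⟨p2.symm, p1.symm⟩

theorem T.w_surj (n : ℕ) : ∀ l : List ℕ, l.Perm (List.range n) → Mz [] l [] →
    ∃ t : T, t.size = n ∧ t.w = l := by
  induction n using Nat.strong_induction_on with
  | _ n ih =>
  intro l hl hM
  cases n with
  | zero => exact ⟨.leaf, rfl, by simpa [w] using hl.symm⟩
  | succ n =>
    have hmem : n ∈ l := hl.mem_iff.2 (by simp)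
    have hnd : l.Nodup := hl.nodup_iff.2 List.nodup_range
    have hlt : ∀ x ∈ l, x < n + 1 := fun x hx => by simpa using hl.mem_iff.1 hx
    obtain ⟨u, t, rfl⟩ := List.append_of_mem hmem
    rcases List.eq_nil_or_concat u with rfl | ⟨s, m, rfl⟩
    · have ht : t.Perm (List.range n) := by
        rw [List.range_succ] at hl
        exact (hl.trans (List.perm_append_singleton _ _)).cons_inv
      have htlt : ∀ x ∈ t, x < n := fun x hx => by simpa using ht.mem_iff.1 hx
      rw [List.nil_append, Mz_lev _ _ htlt] at hM
      obtain ⟨t', h1, h2⟩ := ih n (by omega) t ht hM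
      exact ⟨.lev t', by simp [size, h1], by simp [w, h1, h2]⟩
    · have el : s.concat m ++ n :: t = s ++ m :: n :: t := by simp
      rw [el] at hl hM hnd hlt
      have hM0 := hM
      rw [Mz_append] at hM
      obtain ⟨_, hM⟩ := hM
      rw [Mz, Mz] at hM
      obtain ⟨c1, c2, _⟩ := hM
      simp only [List.nil_append, List.append_nil] at c1 c2
      have hnd' := List.nodup_append'.1 hnd
      have hnt : n ∉ t := by
        have := hnd'.2.1; simp at this; tauto
      have hmt : m ∉ t := by
        have := hnd'.2.1; simp at this; tauto
      have hmn : m < n := by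
        have h1 := hnd'.2.1; simp at h1
        have := hlt m (by simp)
        omega
      have hdis := hnd'.2.2
      have hts : ∀ x ∈ t, x < n := fun x hx => by
        have := hlt x (by simp [hx])
        have : x ≠ n := fun h => hnt (h ▸ hx)
        omega
      have hut : ∀ a ∈ s ++ [m], ∀ c ∈ t, c < a := by
        intro a ha c hc
        have h1 := (c2 a ha).1 c hc
        have h2 := hts c hc
        have h3 : a ≠ c := by
          rintro rfl
          simp at ha
          rcases ha with ha | rfl
          · exact hdis ha (by simp [hc])
          · exact hmt hc
        omega
      have hsm : ∀ a ∈ s, m < a := by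
        intro a ha
        have h1 := (c1 a ha).2 n (by simp)
        have h3 : a ≠ m := by
          rintro rfl
          exact hdis ha (by simp)
        omega
      have hsn : ∀ a ∈ s, a < n := by
        intro a ha
        have := hlt a (by simp [ha])
        have h3 : a ≠ n := by
          rintro rfl
          exact hdis ha (by simp)
        omega
      have htm : ∀ c ∈ t, c < m := fun c hc => hut m (by simp) c hc
      have hst : ∀ a ∈ s, ∀ c ∈ t, c < a := fun a ha c hc => hut a (by simp [ha]) c hc
      rw [Mz_up s t m n hsn hsm htm hmn] at hM0
      have hlen := hl.length_eq
      simp at hlen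
      have A := (split_range (s ++ [m, n]) t (n+1) (by simpa using hl) (by
        intro y hy x hx
        simp at hy
        rcases hy with hy | rfl | rfl
        · exact hst y hy x hx
        · exact htm x hx
        · exact hts x hx)).1
      have hperm2 : ((n :: s) ++ (m :: t)).Perm (List.range (n+1)) := by
        refine List.Perm.trans ?_ hl
        rw [List.perm_iff_count]
        intro x
        simp [List.count_append, List.count_cons]
        omega
      have B := split_range (n :: s) (m :: t) (n+1) hperm2 (by
        intro y hy x hx
        simp at hy hx
        rcases hy with rfl | hy <;> rcases hx with rfl | hx
        · exact hmn
        · exact hts x hx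
        · exact hsm y hy
        · exact hst y hy x hx)
      have hm : m = t.length := by
        have h1 := B.1
        simp only [List.length_cons, List.range_succ] at h1
        have h2 := (h1.trans (List.perm_append_singleton _ _)).trans (A.symm.cons _)
        have h3 := h2.mem_iff (a := m)
        simp at h3
        tauto
      have hs : s.Perm ((List.range s.length).map (· + (t.length + 1))) := by
        have h1 := B.2
        simp only [List.length_cons, List.range_succ, List.map_append, List.map_cons, List.map_nil] at h1
        have h2 := h1.trans (List.perm_append_singleton _ _)
        rw [show t.length + 1 + s.length = n by omega] at h2
        have := h2.cons_inv
        simpa [add_comm] using this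
      have hs' : (s.map (· - (t.length + 1))).Perm (List.range s.length) := by
        have := hs.map (· - (t.length + 1))
        rw [List.map_map] at this
        convert this using 1
        symm
        convert List.map_id _ using 2
        funext x
        simp
      have es : (s.map (· - (t.length + 1))).map (· + (t.length + 1)) = s := by
        rw [List.map_map]
        conv_rhs => rw [← List.map_id s]
        apply List.map_congr_left
        intro a ha
        have := hsm a ha
        simp
        omega
      have hMs : Mz [] (s.map (· - (t.length + 1))) [] := by
        rw [← Mz_map (· + (t.length + 1)) (fun a b h => by simpa using h), es]
        exact hM0.1
      obtain ⟨t', ht1, ht2⟩ := ih t.length (by omega) t A hM0.2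
      obtain ⟨s', hs1, hs2⟩ := ih s.length (by omega) _ hs' hMs
      refine ⟨.up s' t', by simp [size]; omega, ?_⟩
      rw [w, hs2, ht2, ht1, hs1, es, hm, show s.length + t.length + 1 = n by omega]
      simp

theorem inc_single (j m : ℕ) : inc (j+1) 0 [m] = if j = 0 then 1 else 0 := by
  cases j <;> simp [inc]

theorem inc_lev (j : ℕ) (t : T) :
    inc (j+1) 0 (T.lev t).w = (if j = 0 then 1 else 0) + inc (j+1) 0 t.w := by
  have := inc_append [t.size] j t.w (by simpa using t.w_lt)
  rw [T.w, ← inc_single j t.size, ← this]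
  rfl

theorem inc_up (j : ℕ) (s t : T) :
    inc (j+1) 0 (T.up s t).w = inc (j+1) 0 t.w + inc (j+1) 0 s.w + (if j = 0 then 0 else inc j 0 s.w)
      + (if j = 1 then 1 else 0) + 2 * (if j = 0 then 1 else 0) := by
  set s' := s.w.map (· + (t.size + 1)) with hs'
  have hinc : ∀ j, inc j 0 s' = inc j 0 s.w := by
    intro j
    rw [← inc_map (t.size + 1) s.w j 0, ← hs']; symm; apply inc_low
    intro x hx
    simp [hs'] at hx
    obtain ⟨y, _, rfl⟩ := hx
    omega
  have hlo : ∀ x ∈ s', t.size < x := by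
    intro x hx
    simp [hs'] at hx
    obtain ⟨y, _, rfl⟩ := hx
    omega
  have hhi : ∀ x ∈ s', x < s.size + t.size + 1 := by
    intro x hx
    simp [hs'] at hx
    obtain ⟨y, hy, rfl⟩ := hx
    have := s.w_lt y hy
    omega
  have e : (T.up s t).w = ((s' ++ [t.size]) ++ [s.size + t.size + 1]) ++ t.w := by
    simp [T.w, hs']
  rw [e, inc_append, inc_concat_max, inc_append, inc_single, hinc]
  · cases j with
    | zero => simp [inc]; ring
    | succ j =>
      rw [inc_append, inc_single, hinc]
      · simp; ring
      · simpa using hlo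
  · simpa using hlo
  · omega
  · intro x hx
    simp only [List.mem_append, List.mem_singleton] at hx
    rcases hx with hx | rfl
    · exact hhi x hx
    · omega
  · intro y hy x hx
    have := t.w_lt x hx
    simp only [List.mem_append, List.mem_singleton] at hy
    rcases hy with (hy | rfl) | rfl
    · have := hlo y hy; omega
    · omega
    · omega

def st (K : ℕ) : ℕ → T → ℕ
  | _, .leaf => 0
  | d, .lev t => d.choose (K+1) + st K d t
  | d, .up s t => d.choose K + 2 * d.choose (K+1) + st K (d+1) s + st K d t

theorem st_eq (K : ℕ) (t : T) : ∀ d,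
    ∑ ij ∈ Finset.HasAntidiagonal.antidiagonal (K+1), d.choose ij.1 * inc (ij.2 + 1) 0 t.w = st K d t := by
  have z0 : ∀ d : ℕ, ∑ ij ∈ Finset.HasAntidiagonal.antidiagonal (K+1), d.choose ij.1 * (if ij.2 = 0 then 1 else 0)
      = d.choose (K+1) := by
    intro d
    rw [Finset.Nat.antidiagonal_succ']
    simp
  have z1 : ∀ d : ℕ, ∑ ij ∈ Finset.HasAntidiagonal.antidiagonal (K+1), d.choose ij.1 * (if ij.2 = 1 then 1 else 0)
      = d.choose K := by
    intro d
    rw [Finset.Nat.antidiagonal_succ']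
    rw [Finset.sum_cons, Finset.sum_map, Finset.sum_eq_single (K, 0)]
    · simp
    · rintro ⟨i, j⟩ h hne
      have : j ≠ 0 := by
        rintro rfl
        simp at h
        simp [h] at hne
      simp [this]
    · simp
  induction t with
  | leaf => intro d; simp [T.w, inc, st]
  | lev t ih =>
    intro d
    simp only [inc_lev, mul_add, Finset.sum_add_distrib, z0, st, ih]
  | up s t ihs iht =>
    intro d
    have key : ∑ ij ∈ Finset.HasAntidiagonal.antidiagonal (K+1), d.choose ij.1 * inc (ij.2 + 1) 0 s.w +
        ∑ ij ∈ Finset.HasAntidiagonal.antidiagonal (K+1), d.choose ij.1 * (if ij.2 = 0 then 0 else inc ij.2 0 s.w)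
        = st K (d+1) s := by
      rw [← ihs, Finset.Nat.sum_antidiagonal_succ, Finset.Nat.sum_antidiagonal_succ',
        Finset.Nat.sum_antidiagonal_succ]
      simp [Nat.choose_succ_succ, add_mul, Finset.sum_add_distrib]
      ring
    have e2 : ∑ ij ∈ Finset.HasAntidiagonal.antidiagonal (K+1), d.choose ij.1 * (2 * (if ij.2 = 0 then 1 else 0))
      = 2 * d.choose (K+1) := by
      rw [← z0, Finset.mul_sum]
      exact Finset.sum_congr rfl fun _ _ => by ring
    simp only [inc_up, mul_add, Finset.sum_add_distrib, z1, st, iht, e2, ← key]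
    ring

theorem inc_eq_st (K : ℕ) (t : T) : inc (K+2) 0 t.w = st K 0 t := by
  rw [← st_eq, Finset.Nat.sum_antidiagonal_succ]
  simp

theorem fin_trees (n : ℕ) : {t : T | t.size = n}.Finite := by
  have : (Set.image T.w {t : T | t.size = n}).Finite := by
    refine (List.finite_toSet (List.range n).permutations).subset ?_
    rintro _ ⟨t, rfl, rfl⟩
    simpa using t.w_perm
  exact this.of_finite_image T.w_inj.injOn

noncomputable def trees (n : ℕ) : Finset T := (fin_trees n).toFinset

theorem mem_trees {n : ℕ} {t : T} : t ∈ trees n ↔ t.size = n := by simp [trees]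

open Polynomial in
noncomputable def A (K d n : ℕ) : ℚ[X] := ∑ t ∈ trees n, X ^ st K d t

open Classical in
theorem trees_zero : trees 0 = {T.leaf} := by
  ext t
  rw [mem_trees]
  cases t <;> simp [T.size]

open Classical in
theorem trees_one : trees 1 = (trees 0).image T.lev := by
  ext t
  rw [mem_trees]
  cases t <;> simp [T.size, mem_trees]

open Classical in
theorem trees_add_two (n : ℕ) : trees (n+2) = (trees (n+1)).image T.lev ∪
    (Finset.HasAntidiagonal.antidiagonal n).biUnion
      (fun ij => (trees ij.1 ×ˢ trees ij.2).image (fun p => T.up p.1 p.2)) := by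
  ext t
  rw [mem_trees]
  cases t <;> simp [T.size, mem_trees]

theorem lev_inj : Function.Injective T.lev := fun a b h => by simpa using h
theorem up_inj : Function.Injective (fun p : T × T => T.up p.1 p.2) :=
  fun a b h => by simpa [Prod.ext_iff] using h

theorem A_zero (K d : ℕ) : A K d 0 = 1 := by
  simp [A, trees_zero, st]

open Polynomial in
theorem A_one (K d : ℕ) : A K d 1 = X ^ (d.choose (K+1)) * A K d 0 := by
  classical
  rw [A, trees_one, Finset.sum_image lev_inj.injOn, A, Finset.mul_sum]
  simp [st, pow_add]

open Polynomial in
theorem A_add_two (K d n : ℕ) : A K d (n+2) = X ^ (d.choose (K+1)) * A K d (n+1) +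
    X ^ (d.choose K + 2 * d.choose (K+1)) *
      ∑ ij ∈ Finset.HasAntidiagonal.antidiagonal n, A K (d+1) ij.1 * A K d ij.2 := by
  classical
  rw [A, trees_add_two, Finset.sum_union, Finset.sum_image lev_inj.injOn, Finset.sum_biUnion]
  · congr 1
    · rw [A, Finset.mul_sum]
      simp [st, pow_add]
    · rw [Finset.mul_sum]
      refine Finset.sum_congr rfl fun ij _ => ?_
      rw [Finset.sum_image up_inj.injOn, Finset.sum_product, A, A, Finset.sum_mul_sum, Finset.mul_sum]
      refine Finset.sum_congr rfl fun a _ => ?_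
      rw [Finset.mul_sum]
      refine Finset.sum_congr rfl fun b _ => ?_
      simp only [st, pow_add]
      ring
  · intro a _ b _ hab
    rw [Function.onFun, Finset.disjoint_left]
    intro t ht ht'
    simp [mem_trees] at ht ht'
    obtain ⟨x, y, ⟨h1, h2⟩, rfl⟩ := ht
    obtain ⟨x', y', ⟨h1', h2'⟩, h⟩ := ht'
    simp at h
    apply hab
    rw [h.1] at h1'
    rw [h.2] at h2'
    ext <;> omega
  · rw [Finset.disjoint_left]
    intro t ht ht'
    simp at ht ht'
    obtain ⟨x, _, rfl⟩ := ht
    simp at ht'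

noncomputable def G (K d : ℕ) : PowerSeries (Polynomial ℚ) := PowerSeries.mk (A K d)

noncomputable abbrev P : PowerSeries (Polynomial ℚ) := PowerSeries.C Polynomial.X
noncomputable abbrev x : PowerSeries (Polynomial ℚ) := PowerSeries.X

theorem G_rec (K d : ℕ) : G K d = 1 + P ^ (d.choose (K+1)) * (x * G K d) +
    P ^ (d.choose K + 2 * d.choose (K+1)) * (x ^ 2 * (G K (d+1) * G K d)) := by
  ext1 n
  rw [P, ← map_pow, ← map_pow]
  simp only [map_add, PowerSeries.coeff_C_mul]
  rcases n with _ | _ | n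
  · simp [G, A_zero, x]
  · rw [zero_add, show (1:ℕ) = 0 + 1 from rfl, PowerSeries.coeff_succ_X_mul, sq, mul_assoc x x, 
      PowerSeries.coeff_succ_X_mul]
    simp [G, A_one, x, PowerSeries.coeff_one]
  · rw [PowerSeries.coeff_succ_X_mul, sq, mul_assoc x x, 
      PowerSeries.coeff_succ_X_mul, PowerSeries.coeff_succ_X_mul, PowerSeries.coeff_mul]
    simp [G, A_add_two, PowerSeries.coeff_one]

noncomputable def Q (i : ℕ) : PowerSeries (Polynomial ℚ) := PowerSeries.map Polynomial.C (qcheb i)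

theorem Q_rec (i : ℕ) : Q (i+2) = (1 - x) * Q (i+1) - x ^ 2 * Q i := by
  simp [Q, qcheb]

noncomputable def V (i : ℕ) : PowerSeries (Polynomial ℚ) :=
  (1 - x * P) * Q (i+1) - x ^ 2 * P * Q i

theorem G_V (K : ℕ) : ∀ i d, i + d = K → P ^ (K + 3) ∣ G K d * V (i+1) - V i := by
  intro i
  induction i with
  | zero =>
    intro d hd
    obtain rfl : d = K := by omega
    have h1 := G_rec d (d+1)
    have h0 := G_rec d d
    simp at h1 h0
    have q0 : Q 0 = 0 := by simp [Q, qcheb]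
    have q1 : Q 1 = 1 := by simp [Q, qcheb]
    have q2 : Q 2 = 1 - x := by rw [Q_rec, q0, q1]; ring
    refine ⟨x ^ 2 * P * G d d * (x ^ 2 * (G d (d+2) * G d (d+1))), ?_⟩
    simp only [V, zero_add, q0, q1, q2, show 1 + 1 = 2 from rfl]
    generalize G d d = g0 at *
    generalize G d (d+1) = g1 at *
    rw [show d + 1 + 2 = d + 3 by ring, show d + 1 + 1 = d + 2 by ring] at h1
    linear_combination (1 - x * P) * h0 + x ^ 2 * P * g0 * h1
  | succ i ih =>
    intro d hd
    obtain ⟨J, hJ⟩ := ih (d+1) (by omega)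
    have h0 := G_rec K d
    rw [Nat.choose_eq_zero_of_lt (show d < K by omega),
      Nat.choose_eq_zero_of_lt (show d < K + 1 by omega)] at h0
    simp at h0
    refine ⟨x ^ 2 * G K d * J, ?_⟩
    have hV : V (i+1+1) = (1 - x) * V (i+1) - x ^ 2 * V i := by
      simp only [V]
      rw [Q_rec (i+1), Q_rec i]
      ring
    rw [hV]
    linear_combination V (i+1) * h0 + x ^ 2 * G K d * hJ

noncomputable def kap (r : ℕ) (H : PowerSeries (Polynomial ℚ)) : PowerSeries ℚ :=
  PowerSeries.mk fun n => (PowerSeries.coeff n H).coeff r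

theorem kap_add (r : ℕ) (H H') : kap r (H + H') = kap r H + kap r H' := by
  ext n; simp [kap]
theorem kap_sub (r : ℕ) (H H') : kap r (H - H') = kap r H - kap r H' := by
  ext n; simp [kap]
theorem kap_map (r : ℕ) (q H) : kap r (PowerSeries.map Polynomial.C q * H) = q * kap r H := by
  ext n; simp [kap, PowerSeries.coeff_mul, Polynomial.finsetSum_coeff]
theorem kap_P_zero (H) : kap 0 (P * H) = 0 := by
  ext n; simp [kap, P]
theorem kap_P_succ (r H) : kap (r+1) (P * H) = kap r H := by
  ext n; simp [kap, P]
theorem kap_pow (m : ℕ) : ∀ r H, r < m → kap r (P ^ m * H) = 0 := by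
  induction m with
  | zero => intro r H h; omega
  | succ m ih =>
    intro r H h
    rw [pow_succ', mul_assoc]
    cases r with
    | zero => exact kap_P_zero _
    | succ r => rw [kap_P_succ]; exact ih _ _ (by omega)
theorem kap_one_zero : kap 0 1 = 1 := by
  ext n; simp [kap, PowerSeries.coeff_one]; split_ifs <;> simp
theorem kap_one_succ (r) : kap (r+1) 1 = 0 := by
  ext n; simp [kap, PowerSeries.coeff_one]; split_ifs <;> simp [Polynomial.coeff_one]

theorem qdet (i : ℕ) : qcheb (i+1) ^ 2 - qcheb (i+2) * qcheb i = PowerSeries.X ^ (2 * i) := by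
  induction i with
  | zero => simp [qcheb]
  | succ i ih =>
    rw [show 2 * (i+1) = 2 * i + 2 by ring, pow_add, ← ih,
      show qcheb (i+1+2) = (1 - PowerSeries.X) * qcheb (i + 2) - PowerSeries.X ^ 2 * qcheb (i+1) from rfl]
    have : qcheb (i+2) = (1 - PowerSeries.X) * qcheb (i + 1) - PowerSeries.X ^ 2 * qcheb i := rfl
    linear_combination (qcheb (i+2)) * this

theorem gf_final (K r : ℕ) (hr : r + 1 ≤ K + 2) :
    kap (r+1) (G K 0) * qcheb (K+2) ^ (r + 2) = PowerSeries.X ^ (2 * K + r + 2) *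
      (qcheb (K+1) - PowerSeries.X ^ 2 * qcheb K) ^ r := by
  obtain ⟨J, hJ⟩ := G_V K K 0 rfl
  have mX : PowerSeries.map Polynomial.C (PowerSeries.X : PowerSeries ℚ) = x := by simp [x]
  set c := qcheb (K+2) with hc
  set a := qcheb (K+1) with ha
  set b : PowerSeries ℚ := PowerSeries.X * a + PowerSeries.X ^ 2 * qcheb K with hb
  set e : PowerSeries ℚ := PowerSeries.X * c + PowerSeries.X ^ 2 * a with he
  have main : PowerSeries.map Polynomial.C c * G K 0 - PowerSeries.map Polynomial.C e * (P * G K 0) =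
      (PowerSeries.map Polynomial.C a * 1 - PowerSeries.map Polynomial.C b * (P * 1)) + P ^ (K+3) * J := by
    rw [← hJ, hb, he]
    simp only [map_add, map_mul, map_pow, mX, V, Q, ← hc, ← ha]
    ring
  have m0 := congrArg (kap 0) main
  have m1 := congrArg (kap 1) main
  simp only [kap_add, kap_sub, kap_map, kap_P_zero, kap_P_succ, kap_one_zero, kap_one_succ] at m0
  rw [kap_pow _ _ _ (by omega)] at m0
  rw [show 1 = 0 + 1 from rfl] at m1
  simp only [kap_add, kap_sub, kap_map, kap_P_succ, kap_one_zero, kap_one_succ] at m1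
  rw [kap_pow _ _ _ (by omega)] at m1
  have cc : c = (1 - PowerSeries.X) * a - PowerSeries.X ^ 2 * qcheb K := rfl
  have det := qdet K
  rw [← ha, ← hc] at det
  have he' : e = PowerSeries.X * (a - PowerSeries.X ^ 2 * qcheb K) := by
    rw [he, cc]; ring
  induction r with
  | zero =>
    simp only [zero_add, add_zero, pow_zero, mul_one] at m1 ⊢
    rw [pow_add, ← det]
    linear_combination c * m1 + e * m0
  | succ r ih =>
    have ih := ih (by omega)
    have mr := congrArg (kap (r+1+1)) main
    simp only [kap_add, kap_sub, kap_map, kap_P_succ, kap_one_succ] at mr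
    rw [kap_pow _ _ _ (by omega)] at mr
    have : kap (r+1+1) (G K 0) * c = e * kap (r+1) (G K 0) := by linear_combination mr
    calc kap (r+1+1) (G K 0) * c ^ (r+1+2) = (kap (r+1+1) (G K 0) * c) * c ^ (r+2) := by ring
      _ = e * (kap (r+1) (G K 0) * c ^ (r+2)) := by rw [this]; ring
      _ = _ := by rw [ih, he']; ring

theorem sm_cons {α : Type*} [Preorder α] {j : ℕ} (y : α) (h : Fin j → α) :
    StrictMono (Fin.cons y h : Fin (j+1) → α) ↔ (∀ i, y < h i) ∧ StrictMono h := by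
  simp [StrictMono, Fin.forall_fin_succ]

def S (j a : ℕ) {n : ℕ} (g : Fin n → ℕ) : Set (Fin j → Fin n) :=
  {f | StrictMono f ∧ StrictMono (fun i => g (f i)) ∧ ∀ i, a ≤ g (f i)}

theorem S_card (n : ℕ) : ∀ (g : Fin n → ℕ) (j a : ℕ), (S j a g).ncard = inc j a (List.ofFn g) := by
  induction n with
  | zero =>
    intro g j a
    cases j with
    | zero =>
      rw [inc, Set.ncard_eq_one]
      refine ⟨Fin.elim0, ?_⟩
      ext f
      simp [S, StrictMono, Subsingleton.elim f Fin.elim0]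
    | succ j =>
      simp only [List.ofFn_zero, inc]
      rw [Set.ncard_eq_zero]
      ext f
      exact (f 0).elim0
  | succ n ih =>
    intro g j a
    cases j with
    | zero =>
      rw [inc, Set.ncard_eq_one]
      refine ⟨Fin.elim0, ?_⟩
      ext f
      simp [S, StrictMono, Subsingleton.elim f Fin.elim0]
    | succ j =>
      rw [List.ofFn_succ, inc, ← ih, ← ih]
      set g' : Fin n → ℕ := fun i => g i.succ with hg'
      let φ : (Fin (j+1) → Fin n) → (Fin (j+1) → Fin (n+1)) := fun f i => (f i).succ
      let ψ : (Fin j → Fin n) → (Fin (j+1) → Fin (n+1)) := fun f => Fin.cons 0 (fun i => (f i).succ)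
      have hφ : Function.Injective φ := by
        intro f f' h
        funext i
        exact Fin.succ_injective _ (congrFun h i)
      have hψ : Function.Injective ψ := by
        intro f f' h
        funext i
        have := congrFun h i.succ
        simpa [ψ] using this
      have key : S (j+1) a g = Set.image φ (S (j+1) a g') ∪
          (if a ≤ g 0 then Set.image ψ (S j (g 0 + 1) g') else ∅) := by
        ext f
        constructor
        · rintro ⟨h1, h2, h3⟩
          by_cases h0 : f 0 = 0
          · right
            have ha : a ≤ g 0 := by have := h3 0; rwa [h0] at this
            rw [if_pos ha]
            have hne : ∀ i : Fin j, f i.succ ≠ 0 := by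
              intro i hi
              have := h1 (Fin.succ_pos i)
              rw [h0, hi] at this
              exact lt_irrefl _ this
            refine ⟨fun i => (f i.succ).pred (hne i), ⟨?_, ?_, ?_⟩, ?_⟩
            · intro i i' hi
              simpa using h1 (Fin.succ_lt_succ_iff.2 hi)
            · intro i i' hi
              simpa [g'] using h2 (Fin.succ_lt_succ_iff.2 hi)
            · intro i
              have := h2 (Fin.succ_pos i)
              simp only [h0] at this
              simpa [g'] using this
            · funext i
              refine Fin.cases ?_ (fun i => ?_) i
              · simp [ψ, h0]
              · simp [ψ]
          · left
            have hne : ∀ i : Fin (j+1), f i ≠ 0 := by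
              intro i hi
              have := h1.monotone (Fin.zero_le i)
              rw [hi] at this
              exact h0 (Fin.le_zero_iff.1 this)
            refine ⟨fun i => (f i).pred (hne i), ⟨?_, ?_, ?_⟩, ?_⟩
            · intro i i' hi
              simpa using h1 hi
            · intro i i' hi
              simpa [g'] using h2 hi
            · intro i
              simpa [g'] using h3 i
            · funext i
              simp [φ]
        · rintro (⟨h, ⟨h1, h2, h3⟩, rfl⟩ | hf)
          · exact ⟨fun i i' hi => Fin.succ_lt_succ_iff.2 (h1 hi), h2, h3⟩
          · split_ifs at hf with ha
            · obtain ⟨h, ⟨h1, h2, h3⟩, rfl⟩ := hf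
              refine ⟨?_, ?_, ?_⟩
              · rw [sm_cons]
                exact ⟨fun i => Fin.succ_pos _, fun i i' hi => Fin.succ_lt_succ_iff.2 (h1 hi)⟩
              · have e : (fun i => g (ψ h i)) = Fin.cons (g 0) (fun i => g' (h i)) := by
                  funext i
                  refine Fin.cases ?_ (fun i => ?_) i <;> simp [ψ, g']
                rw [e, sm_cons]
                exact ⟨h3, h2⟩
              · intro i
                refine Fin.cases ?_ (fun i => ?_) i
                · simpa [ψ] using ha
                · have := h3 i
                  simp [ψ, g'] at this ⊢
                  omega
            · exact hf.elim
      rw [key, Set.ncard_union_eq _ (Set.toFinite _) (Set.toFinite _),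
        Set.ncard_image_of_injective _ hφ]
      · split_ifs
        · rw [Set.ncard_image_of_injective _ hψ]
        · simp
      · rw [Set.disjoint_left]
        rintro _ ⟨f, _, rfl⟩ hf
        split_ifs at hf
        · obtain ⟨f', _, h⟩ := hf
          have := congrFun h 0
          simp [φ, ψ] at this
          exact Fin.succ_ne_zero _ this.symm
        · exact hf

def L {n : ℕ} (π : Equiv.Perm (Fin n)) : List ℕ := List.ofFn (fun i => (π i : ℕ))

theorem nIncr_eq {n : ℕ} (π : Equiv.Perm (Fin n)) (j : ℕ) : nIncr j π = inc j 0 (L π) := by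
  rw [L, ← S_card, nIncr, ← Nat.card_coe_set_eq]
  apply Nat.card_congr
  refine Equiv.subtypeEquivRight fun f => ?_
  simp [S, StrictMono]

theorem L_inj {n : ℕ} : Function.Injective (L (n := n)) := by
  intro π π' h
  have := List.ofFn_injective h
  ext i
  exact congrFun this i

theorem L_perm {n : ℕ} (π : Equiv.Perm (Fin n)) : (L π).Perm (List.range n) := by
  rw [List.perm_ext_iff_of_nodup _ List.nodup_range]
  · intro a
    simp only [L, List.mem_ofFn, List.mem_range]
    constructor
    · rintro ⟨i, rfl⟩; exact (π i).2
    · intro ha; exact ⟨π.symm ⟨a, ha⟩, by simp⟩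
  · rw [L, List.nodup_ofFn]
    intro i i' h
    exact π.injective (Fin.ext h)

theorem L_surj {n : ℕ} (l : List ℕ) (h : l.Perm (List.range n)) :
    ∃ π : Equiv.Perm (Fin n), L π = l := by
  have hlen : l.length = n := by simpa using h.length_eq
  have hnd : l.Nodup := h.nodup_iff.2 List.nodup_range
  let f : Fin n → Fin n := fun i => ⟨l[(i:ℕ)]'(by omega), by
    simpa using h.mem_iff.1 (List.getElem_mem (l := l) (n := i) (by omega))⟩
  have hf : Function.Injective f := by
    intro i i' hh
    have := congrArg Fin.val hh
    simp only [f] at this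
    exact Fin.ext ((hnd.getElem_inj_iff).1 this)
  refine ⟨Equiv.ofBijective f (Finite.injective_iff_bijective.1 hf), ?_⟩
  apply List.ext_getElem
  · simp [L, hlen]
  · intro i h1 h2
    simp [L, f]

theorem motz_iff {n : ℕ} (π : Equiv.Perm (Fin n)) : IsMotzkinPerm π ↔ Mz [] (L π) [] := by
  have hlen : (L π).length = n := by simp [L]
  have hget : ∀ i (h : i < (L π).length), (L π)[i] = (π ⟨i, hlen ▸ h⟩ : ℕ) := by
    intro i h; simp [L]
  rw [Mz_iff]
  constructor
  · rintro ⟨h1, h2⟩ j hj a ha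
    simp only [List.nil_append, List.append_nil] at ha ⊢
    obtain ⟨i, hi, rfl⟩ := List.mem_iff_getElem.1 ha
    have hi' : i < j := by simp at hi; omega
    have hj' : j < n := hlen ▸ hj
    rw [List.getElem_take, hget, hget]
    refine ⟨fun c hc => ?_, fun c hc => ?_⟩
    · obtain ⟨m, hm, rfl⟩ := List.mem_iff_getElem.1 hc
      rw [List.getElem_drop, hget]
      rintro ⟨h3, h4⟩
      exact h1 ⟨⟨i, by omega⟩, ⟨j, hj'⟩, ⟨j + 1 + m, _⟩, hi', by simp [Fin.lt_def]; omega, h3, h4⟩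
    · rw [List.head?_drop, Option.mem_def, List.getElem?_eq_some_iff] at hc
      obtain ⟨hm, rfl⟩ := hc
      rw [hget]
      rintro ⟨h3, h4⟩
      exact h2 ⟨⟨i, by omega⟩, ⟨j, hj'⟩, lt_of_lt_of_eq hm hlen, hi', h3, h4⟩
  · intro h
    have memtake : ∀ (i j : Fin n), i < j → (π i : ℕ) ∈ (L π).take j := by
      intro i j hij
      rw [List.mem_iff_getElem]
      have : (i:ℕ) < j := hij
      refine ⟨i, by simp [hlen]; omega, ?_⟩
      rw [List.getElem_take, hget]
    constructor
    · rintro ⟨i, j, m, hij, hjm, h3, h4⟩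
      have := (h j (by rw [hlen]; exact j.2) (π i) (by simpa using memtake i j hij)).1 (π m) (by
        rw [List.append_nil, List.mem_iff_getElem]
        have hjm' : (j:ℕ) < m := hjm
        refine ⟨m - (j+1), by simp [hlen]; omega, ?_⟩
        rw [List.getElem_drop, hget]
        congr 3
        omega)
      rw [hget] at this
      exact this ⟨h3, h4⟩
    · rintro ⟨i, j, hj, hij, h3, h4⟩
      have := (h j (by rw [hlen]; exact j.2) (π i) (by simpa using memtake i j hij)).2 (π ⟨j+1, hj⟩) (by
        rw [List.append_nil, List.head?_drop, Option.mem_def, List.getElem?_eq_some_iff]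
        exact ⟨by rw [hlen]; exact hj, hget _ _⟩)
      rw [hget] at this
      exact this ⟨h3, h4⟩

theorem count_eq (K n r : ℕ) :
    (Nat.card {π : Equiv.Perm (Fin n) // IsMotzkinPerm π ∧ nIncr (K+2) π = r} : ℚ) =
      (A K 0 n).coeff r := by
  classical
  have h1 : Nat.card {π : Equiv.Perm (Fin n) // IsMotzkinPerm π ∧ nIncr (K+2) π = r} =
      {π : Equiv.Perm (Fin n) | IsMotzkinPerm π ∧ nIncr (K+2) π = r}.ncard := rfl
  have h2 : Set.image L {π : Equiv.Perm (Fin n) | IsMotzkinPerm π ∧ nIncr (K+2) π = r} =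
      Set.image T.w ((trees n).filter (fun t => st K 0 t = r) : Finset T) := by
    ext l
    constructor
    · rintro ⟨π, ⟨hm, hr⟩, rfl⟩
      rw [motz_iff] at hm
      rw [nIncr_eq] at hr
      obtain ⟨t, ht, hw⟩ := T.w_surj n (L π) (L_perm π) hm
      refine ⟨t, ?_, hw⟩
      rw [← hw, inc_eq_st] at hr
      simp [mem_trees, ht, hr]
    · rintro ⟨t, ht, rfl⟩
      simp [mem_trees] at ht
      obtain ⟨rfl, hr⟩ := ht
      obtain ⟨π, hπ⟩ := L_surj t.w t.w_perm
      refine ⟨π, ⟨?_, ?_⟩, hπ⟩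
      · rw [motz_iff, hπ]; exact t.w_Mz
      · rw [nIncr_eq, hπ, inc_eq_st, hr]
  rw [h1, ← Set.ncard_image_of_injective _ L_inj, h2, Set.ncard_image_of_injective _ T.w_inj,
    Set.ncard_coe_finset, A, Polynomial.finsetSum_coeff]
  simp [Polynomial.coeff_X_pow, Finset.sum_ite, eq_comm]

end MotzAux

/-- For `k ≥ 2` and `1 ≤ r ≤ k`, the generating function `F_r` for Motzkin permutations with
exactly `r` occurrences of `12…k` satisfies
`F_r · q_{k-1}^{r+1} = x^{2k+r-3} (q_{k-2} - x² q_{k-3})^{r-1}`. -/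
theorem count_exactly_r_incr_k (k r : ℕ) (hk : 2 ≤ k) (hr1 : 1 ≤ r) (hrk : r ≤ k) :
    (PowerSeries.mk fun n =>
        (Nat.card {π : Equiv.Perm (Fin n) // IsMotzkinPerm π ∧ nIncr k π = r} : ℚ)) *
      qcheb k ^ (r + 1) =
      PowerSeries.X ^ (2 * k + r - 3) *
        (qcheb (k - 1) - PowerSeries.X ^ 2 * qcheb (k - 2)) ^ (r - 1) := by
  obtain ⟨K, rfl⟩ : ∃ K, k = K + 2 := ⟨k - 2, by omega⟩
  obtain ⟨r, rfl⟩ : ∃ r', r = r' + 1 := ⟨r - 1, by omega⟩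
  have h := MotzAux.gf_final K r hrk
  have e : (PowerSeries.mk fun n =>
      (Nat.card {π : Equiv.Perm (Fin n) // IsMotzkinPerm π ∧ nIncr (K+2) π = r+1} : ℚ)) =
      MotzAux.kap (r+1) (MotzAux.G K 0) := by
    ext n
    rw [PowerSeries.coeff_mk, MotzAux.count_eq]
    simp [MotzAux.kap, MotzAux.G]
  rw [e, show 2 * (K+2) + (r+1) - 3 = 2 * K + r + 2 by omega, show K + 2 - 1 = K + 1 by omega,
    show K + 2 - 2 = K by omega, show r + 1 - 1 = r by omega]
  exact h
end

section
/- Let k ≥ 4 and let τ be a Motzkin permutation of length k with τ_{k−1} = 1 and τ_k = k (so τ = (ρ', 1, k) where ρ' = (τ_1,…,τ_{k−2}) is a rearrangement of {2,…,k−1}); let ρ be the Motzkin permutation of length k−2 obtained from ρ' by decreasing each entry by 1. Then N_τ(x)·(1 − x − x²·N_ρ(x)) = 1, i.e., N_τ(x) = 1/(1 − x − x² N_ρ(x)). -/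
/-- `π` contains the classical pattern `τ`. -/
def ContainsPatt {k n : ℕ} (τ : Equiv.Perm (Fin k)) (π : Equiv.Perm (Fin n)) : Prop :=
  ∃ f : Fin k → Fin n, StrictMono f ∧ ∀ i j : Fin k, τ i < τ j ↔ π (f i) < π (f j)

/-- `Ngf τ` is the generating function `∑_n |𝔐_n(τ)| xⁿ` for Motzkin permutations
avoiding the classical pattern `τ`. -/
noncomputable def Ngf {k : ℕ} (τ : Equiv.Perm (Fin k)) : PowerSeries ℚ :=
  PowerSeries.mk fun n =>
    (Nat.card {π : Equiv.Perm (Fin n) // IsMotzkinPerm π ∧ ¬ ContainsPatt τ π} : ℚ)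

/-- Word form of a permutation: values on `x < n`, zero beyond. -/
def wd {n : ℕ} (π : Equiv.Perm (Fin n)) (x : ℕ) : ℕ := if h : x < n then (π ⟨x, h⟩ : ℕ) else 0

/-- Words of Motzkin permutations. -/
structure MW (n : ℕ) (w : ℕ → ℕ) : Prop where
  lt : ∀ x, x < n → w x < n
  inj : ∀ x y, x < n → y < n → w x = w y → x = y
  out : ∀ x, n ≤ x → w x = 0
  a132 : ∀ x y z, x < y → y < z → z < n → w x < w z → w z < w y → False
  a123 : ∀ x y, x < y → y + 1 < n → w x < w y → w y < w (y + 1) → False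

/-- Containment for words. -/
def CW (k : ℕ) (t : ℕ → ℕ) (n : ℕ) (w : ℕ → ℕ) : Prop :=
  ∃ f : ℕ → ℕ, (∀ i j, i < j → j < k → f i < f j) ∧ (∀ i, i < k → f i < n) ∧
    ∀ i j, i < k → j < k → (t i < t j ↔ w (f i) < w (f j))

/-- Good words. -/
def GW (k : ℕ) (t : ℕ → ℕ) (n : ℕ) : Set (ℕ → ℕ) := {w | MW n w ∧ ¬ CW k t n w}

lemma wd_fin {n : ℕ} (π : Equiv.Perm (Fin n)) (x : Fin n) : wd π x = (π x : ℕ) := by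
  simp [wd]

lemma MW_wd {n : ℕ} (π : Equiv.Perm (Fin n)) : MW n (wd π) ↔ IsMotzkinPerm π := by
  constructor
  · rintro ⟨_, _, _, h1, h2⟩
    refine ⟨?_, ?_⟩
    · rintro ⟨x, y, z, h, h', h3, h4⟩
      exact h1 x y z h h' z.2 (by simpa [wd_fin] using h3) (by simpa [wd_fin] using h4)
    · rintro ⟨x, y, hy, h, h3, h4⟩
      refine h2 x y h hy (by simpa [wd_fin] using h3) ?_
      have := wd_fin π ⟨y + 1, hy⟩
      simp only at this
      rw [this, wd_fin]
      exact h4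
  · rintro ⟨h1, h2⟩
    refine ⟨?_, ?_, ?_, ?_, ?_⟩
    · intro x hx; simp [wd, hx]
    · intro x y hx hy h
      simp only [wd, hx, hy, dif_pos] at h
      have := π.injective (Fin.ext h)
      simpa using this
    · intro x hx; simp [wd, not_lt.2 hx]
    · intro x y z hxy hyz hz a b
      have hy := hyz.trans hz
      have hx := hxy.trans hy
      simp only [wd, hx, hy, hz, dif_pos] at a b
      exact h1 ⟨⟨x, hx⟩, ⟨y, hy⟩, ⟨z, hz⟩, hxy, hyz, a, b⟩
    · intro x y hxy hz a b
      have hy : y < n := by omega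
      have hx := hxy.trans hy
      simp only [wd, hx, hy, hz, dif_pos] at a b
      exact h2 ⟨⟨x, hx⟩, ⟨y, hy⟩, hz, hxy, a, b⟩

lemma CW_wd {k n : ℕ} (τ : Equiv.Perm (Fin k)) (π : Equiv.Perm (Fin n)) :
    CW k (wd τ) n (wd π) ↔ ContainsPatt τ π := by
  constructor
  · rintro ⟨f, h1, h2, h3⟩
    refine ⟨fun i => ⟨f i, h2 i i.2⟩, fun i j hij => h1 i j hij j.2, fun i j => ?_⟩
    have := h3 i j i.2 j.2
    simpa [wd, h2] using this
  · rintro ⟨f, h1, h2⟩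
    refine ⟨fun x => if h : x < k then (f ⟨x, h⟩ : ℕ) else 0, ?_, ?_, ?_⟩
    · intro i j hij hj
      have hi := hij.trans hj
      simp only [hi, hj, dif_pos]
      exact h1 (show (⟨i, hi⟩ : Fin k) < ⟨j, hj⟩ from hij)
    · intro i hi; simp [hi]
    · intro i j hi hj
      have := h2 ⟨i, hi⟩ ⟨j, hj⟩
      simpa [wd, hi, hj] using this

/-- Permutations to good words. -/
def toGW {k : ℕ} (τ : Equiv.Perm (Fin k)) (n : ℕ)
    (π : {π : Equiv.Perm (Fin n) // IsMotzkinPerm π ∧ ¬ ContainsPatt τ π}) :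
    GW k (wd τ) n :=
  ⟨wd π.1, (MW_wd _).2 π.2.1, fun h => π.2.2 ((CW_wd _ _).1 h)⟩

lemma toGW_bij {k : ℕ} (τ : Equiv.Perm (Fin k)) (n : ℕ) : Function.Bijective (toGW τ n) := by
  constructor
  · rintro ⟨a, ha⟩ ⟨b, hb⟩ h
    have h : wd a = wd b := congrArg Subtype.val h
    ext x
    have := congrFun h x
    simpa [wd_fin] using this
  · rintro ⟨w, hw, hc⟩
    let g : Fin n → Fin n := fun x => ⟨w x, hw.lt x x.2⟩
    have hg : Function.Injective g := fun x y h =>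
      Fin.ext (hw.inj x y x.2 y.2 (congrArg Fin.val h))
    let π := Equiv.ofBijective g (Finite.injective_iff_bijective.1 hg)
    have hπ : wd π = w := by
      funext x
      by_cases hx : x < n
      · simp [wd, hx, π, g]
      · simp [wd, hx, hw.out x (not_lt.1 hx)]
    have h1 : IsMotzkinPerm π := (MW_wd _).1 (hπ ▸ hw)
    have h2 : ¬ ContainsPatt τ π := fun h => hc (hπ ▸ (CW_wd _ _).2 h)
    exact ⟨⟨π, h1, h2⟩, Subtype.ext hπ⟩

instance GW_finite {k : ℕ} (τ : Equiv.Perm (Fin k)) (n : ℕ) : Finite (GW k (wd τ) n) :=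
  Finite.of_surjective _ (toGW_bij τ n).2

lemma card_GW {k : ℕ} (τ : Equiv.Perm (Fin k)) (n : ℕ) :
    Nat.card {π : Equiv.Perm (Fin n) // IsMotzkinPerm π ∧ ¬ ContainsPatt τ π}
      = Nat.card (GW k (wd τ) n) :=
  Nat.card_congr (Equiv.ofBijective _ (toGW_bij τ n))

/-- Gluing. -/
def glue (i l : ℕ) (u v : ℕ → ℕ) (x : ℕ) : ℕ :=
  if x < i then u x + (l + 1) else if x = i then l else if x = i + 1 then i + l + 1
  else v (x - (i + 2))

/-- Left part of a word. -/
def cutL (i l : ℕ) (w : ℕ → ℕ) (x : ℕ) : ℕ := if x < i then w x - (l + 1) else 0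
/-- Right part of a word. -/
def cutR (i : ℕ) (w : ℕ → ℕ) (x : ℕ) : ℕ := w (x + i + 2)

/-- Structure of Motzkin words with maximum in position `i+1`. -/
lemma MW_shape {i l : ℕ} {w : ℕ → ℕ} (hw : MW (i + l + 2) w) (hm : w (i + 1) = i + l + 1) :
    (∀ x, x < i → l + 1 ≤ w x) ∧ w i = l ∧ ∀ x, i + 2 ≤ x → x < i + l + 2 → w x < l := by
  have hsep : ∀ x y, x ≤ i → i + 2 ≤ y → y < i + l + 2 → w y < w x := by
    intro x y hx hy hyn
    by_contra hcon
    have h1 : w x ≠ w y := fun h => by have := hw.inj x y (by omega) hyn h; omega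
    have h2 : w y ≠ w (i + 1) := fun h => by have := hw.inj y (i + 1) hyn (by omega) h; omega
    have h3 := hw.lt y hyn
    exact hw.a132 x (i + 1) y (by omega) (by omega) hyn (by omega) (by omega)
  have hmin : ∀ x, x < i → w i < w x := by
    intro x hx
    by_contra hcon
    have h1 : w x ≠ w i := fun h => by have := hw.inj x i (by omega) (by omega) h; omega
    have h2 : w i ≠ w (i + 1) := fun h => by
      have := hw.inj i (i + 1) (by omega) (by omega) h; omega
    have h3 := hw.lt i (by omega)
    exact hw.a123 x i hx (by omega) (by omega) (by omega)
  have hge : ∀ x, x ≤ i → l ≤ w x := by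
    intro x hx
    have := Finset.card_le_card_of_injOn (s := Finset.Ico (i + 2) (i + l + 2))
      (t := Finset.range (w x)) w
      (by intro y hy; simp at hy ⊢; exact hsep x y hx hy.1 hy.2)
      (by intro a ha b hb h; simp at ha hb; exact hw.inj a b ha.2 hb.2 h)
    simp at this; omega
  have hile : w i ≤ l := by
    have := Finset.card_le_card_of_injOn (s := (Finset.range (i + 2)).erase i)
      (t := Finset.Ioo (w i) (i + l + 2)) w
      (by
        intro y hy
        simp at hy ⊢
        refine ⟨?_, hw.lt y (by omega)⟩
        rcases (show y < i ∨ y = i + 1 by omega) with h | h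
        · exact hmin y h
        · subst h
          have h2 : w i ≠ w (i + 1) := fun h => by
            have := hw.inj i (i + 1) (by omega) (by omega) h; omega
          have := hw.lt i (by omega)
          omega)
      (by intro a ha b hb h; simp at ha hb; exact hw.inj a b (by omega) (by omega) h)
    have h3 := hw.lt i (by omega)
    rw [Finset.card_erase_of_mem (by simp)] at this
    simp at this; omega
  have hi : w i = l := le_antisymm hile (hge i le_rfl)
  exact ⟨fun x hx => by have := hmin x hx; omega, hi,
    fun x hx hxn => by have := hsep i x le_rfl hx hxn; omega⟩

lemma MW_glue {i l : ℕ} {u v : ℕ → ℕ} (hu : MW i u) (hv : MW l v) :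
    MW (i + l + 2) (glue i l u v) := by
  obtain ⟨u1, u2, u3, u4, u5⟩ := hu
  obtain ⟨v1, v2, v3, v4, v5⟩ := hv
  refine ⟨?_, ?_, ?_, ?_, ?_⟩
  · intro x hx
    have := u1 x
    have := v1 (x - (i + 2))
    unfold glue; split_ifs <;> omega
  · intro x y hx hy h
    have := u1 x
    have := v1 (x - (i + 2))
    have := u1 y
    have := v1 (y - (i + 2))
    have := u2 x y
    have := v2 (x - (i + 2)) (y - (i + 2))
    unfold glue at h; split_ifs at h <;> omega
  · intro x hx
    have := v3 (x - (i + 2))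
    unfold glue; split_ifs <;> omega
  · intro x y z hxy hyz hz a b
    have := u1 x
    have := v1 (x - (i + 2))
    have := u1 y
    have := v1 (y - (i + 2))
    have := u1 z
    have := v1 (z - (i + 2))
    have h1 : ¬ (x < y ∧ y < z ∧ z < i ∧ u x < u z ∧ u z < u y) :=
      fun ⟨a, b, c, d, e⟩ => u4 x y z a b c d e
    have h2 : ¬ (x - (i + 2) < y - (i + 2) ∧ y - (i + 2) < z - (i + 2) ∧ z - (i + 2) < l ∧
        v (x - (i + 2)) < v (z - (i + 2)) ∧ v (z - (i + 2)) < v (y - (i + 2))) :=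
      fun ⟨a, b, c, d, e⟩ => v4 _ _ _ a b c d e
    unfold glue at a b; split_ifs at a b <;> omega
  · intro x y hxy hz a b
    have := u1 x
    have := v1 (x - (i + 2))
    have := u1 y
    have := v1 (y - (i + 2))
    have := u1 (y + 1)
    have h0 := v1 (y + 1 - (i + 2))
    have h1 : ¬ (x < y ∧ y + 1 < i ∧ u x < u y ∧ u y < u (y + 1)) :=
      fun ⟨a, b, c, d⟩ => u5 x y a b c d
    have h2 : ¬ (x - (i + 2) < y - (i + 2) ∧ y - (i + 2) + 1 < l ∧
        v (x - (i + 2)) < v (y - (i + 2)) ∧ v (y - (i + 2)) < v (y - (i + 2) + 1)) :=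
      fun ⟨a, b, c, d⟩ => v5 _ _ a b c d
    by_cases hy : i + 2 ≤ y
    · rw [show y - (i + 2) + 1 = y + 1 - (i + 2) by omega] at h2
      unfold glue at a b; split_ifs at a b <;> omega
    · clear h2
      unfold glue at a b; split_ifs at a b <;> omega

lemma MW_cutL {i l : ℕ} {w : ℕ → ℕ} (hw : MW (i + l + 2) w) (hm : w (i + 1) = i + l + 1) :
    MW i (cutL i l w) := by
  obtain ⟨s1, s2, s3⟩ := MW_shape hw hm
  obtain ⟨w1, w2, w3, w4, w5⟩ := hw
  refine ⟨?_, ?_, ?_, ?_, ?_⟩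
  · intro x hx
    have h1 := w1 x (by omega)
    have h2 := w2 x (i + 1) (by omega) (by omega)
    have := s1 x hx
    simp only [cutL, hx, if_true]; omega
  · intro x y hx hy h
    have := s1 x hx
    have := s1 y hy
    simp only [cutL, hx, hy, if_true] at h
    exact w2 x y (by omega) (by omega) (by omega)
  · intro x hx; simp [cutL, not_lt.2 hx]
  · intro x y z hxy hyz hz a b
    have hy := hyz.trans hz
    have hx := hxy.trans hy
    have := s1 x hx
    have := s1 y hy
    have := s1 z hz
    simp only [cutL, hx, hy, hz, if_true] at a b
    exact w4 x y z hxy hyz (by omega) (by omega) (by omega)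
  · intro x y hxy hz a b
    have hy : y < i := by omega
    have hx := hxy.trans hy
    have := s1 x hx
    have := s1 y hy
    have := s1 _ hz
    simp only [cutL, hx, hy, hz, if_true] at a b
    exact w5 x y hxy (by omega) (by omega) (by omega)

lemma MW_cutR {i l : ℕ} {w : ℕ → ℕ} (hw : MW (i + l + 2) w) (hm : w (i + 1) = i + l + 1) :
    MW l (cutR i w) := by
  obtain ⟨s1, s2, s3⟩ := MW_shape hw hm
  obtain ⟨w1, w2, w3, w4, w5⟩ := hw
  refine ⟨?_, ?_, ?_, ?_, ?_⟩
  · intro x hx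
    exact s3 _ (by omega) (by omega)
  · intro x y hx hy h
    have := w2 _ _ (by omega) (by omega) h
    omega
  · intro x hx; exact w3 _ (by omega)
  · intro x y z hxy hyz hz a b
    exact w4 _ _ _ (by omega) (by omega) (by omega) a b
  · intro x y hxy hz a b
    unfold cutR at a b
    rw [show y + 1 + i + 2 = (y + i + 2) + 1 by omega] at b
    exact w5 _ _ (by omega) (by omega) a b

lemma glue_cut {i l : ℕ} {w : ℕ → ℕ} (hw : MW (i + l + 2) w) (hm : w (i + 1) = i + l + 1) :
    glue i l (cutL i l w) (cutR i w) = w := by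
  obtain ⟨s1, s2, s3⟩ := MW_shape hw hm
  funext x
  have := s1 x
  unfold glue cutL cutR
  split_ifs with h1 h2 h3
  · omega
  · rw [h2, s2]
  · rw [h3, hm]
  · congr 1; omega

lemma CW_glue {q i l : ℕ} {t r u v : ℕ → ℕ} (hu : MW i u) (hv : MW l v)
    (H1 : ∀ p, p < q + 1 → t p < t (q + 1)) (H2 : ∀ p, p < q → t q < t p)
    (H3 : ∀ a b, a < q → b < q → (r a < r b ↔ t a < t b)) :
    CW (q + 2) t (i + l + 2) (glue i l u v) ↔ CW q r i u ∨ CW (q + 2) t l v := by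
  have g1 : ∀ x, x < i → glue i l u v x = u x + (l + 1) := fun x hx => by simp [glue, hx]
  have g2 : glue i l u v i = l := by simp [glue]
  have g3 : glue i l u v (i + 1) = i + l + 1 := by simp [glue]
  have g4 : ∀ x, glue i l u v (x + (i + 2)) = v x := fun x => by
    unfold glue; split_ifs <;> first | omega | simp
  constructor
  · rintro ⟨f, f1, f2, f3⟩
    by_cases hc : i + 2 ≤ f (q + 1)
    · right
      have key : ∀ p, p < q + 2 → i + 2 ≤ f p := by
        intro p hp
        by_contra hcon
        have hp' : p < q + 1 := by
          by_contra h
          have : p = q + 1 := by omega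
          subst this; omega
        have h1 := (f3 p (q + 1) hp (by omega)).1 (H1 p hp')
        have h2 := f2 (q + 1) (by omega)
        have h3 := g4 (f (q + 1) - (i + 2))
        rw [Nat.sub_add_cancel hc] at h3
        have h4 := hv.lt (f (q + 1) - (i + 2)) (by omega)
        have h5 : l ≤ glue i l u v (f p) := by
          unfold glue; split_ifs <;> omega
        omega
      refine ⟨fun p => f p - (i + 2), ?_, ?_, ?_⟩
      · intro a b hab hb
        have := f1 a b hab hb
        have := key a (by omega)
        simp only; omega
      · intro a ha
        have := f2 a ha
        have := key a ha
        simp only; omega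
      · intro a b ha hb
        rw [f3 a b ha hb, ← g4, ← g4, Nat.sub_add_cancel (key a ha), Nat.sub_add_cancel (key b hb)]
    · left
      have key : ∀ p, p < q → f p < i := by
        intro p hp
        have := f1 p q hp (by omega)
        have := f1 q (q + 1) (by omega) (by omega)
        omega
      refine ⟨f, fun a b hab hb => f1 a b hab (by omega), key, ?_⟩
      intro a b ha hb
      rw [H3 a b ha hb, f3 a b (by omega) (by omega), g1 _ (key a ha), g1 _ (key b hb)]
      omega
  · rintro (⟨f, f1, f2, f3⟩ | ⟨f, f1, f2, f3⟩)
    · refine ⟨fun p => if p < q then f p else if p = q then i else i + 1, ?_, ?_, ?_⟩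
      · intro a b hab hb
        have := f1 a b hab
        have := f2 a
        simp only; split_ifs <;> omega
      · intro a ha
        have := f2 a
        simp only; split_ifs <;> omega
      · intro a b ha hb
        have c : ∀ a, a < q + 2 → a < q ∨ a = q ∨ a = q + 1 := by intro a; omega
        rcases c a ha with h | h | h <;> rcases c b hb with h' | h' | h'
        · simp only [h, h', if_true]
          rw [g1 _ (f2 a h), g1 _ (f2 b h'), ← H3 a b h h', f3 a b h h']; omega
        · subst h'
          have := H2 a h
          simp only [h, if_true, lt_irrefl, if_false]
          rw [g1 _ (f2 a h), g2]; omega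
        · subst h'
          have := H1 a (by omega)
          have h0 := hu.lt _ (f2 a h)
          simp [h]
          rw [g1 _ (f2 a h), g3]; omega
        · subst h
          have := H2 b h'
          simp only [h', if_true, lt_irrefl, if_false]
          rw [g1 _ (f2 b h'), g2]; omega
        · subst h; subst h'; simp
        · subst h; subst h'
          have := H1 a (by omega)
          simp
          rw [g2, g3]; omega
        · subst h
          have := H1 b (by omega)
          have h0 := hu.lt _ (f2 b h')
          simp [h']
          rw [g1 _ (f2 b h'), g3]; omega
        · subst h; subst h'
          have := H1 b (by omega)
          simp
          rw [g2, g3]; omega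
        · subst h; subst h'; simp
    · refine ⟨fun p => f p + (i + 2), ?_, ?_, ?_⟩
      · intro a b hab hb
        have := f1 a b hab hb
        simp only; omega
      · intro a ha
        have := f2 a ha
        simp only; omega
      · intro a b ha hb
        simp only [g4]; exact f3 a b ha hb

lemma card_fib_succ {q i l n : ℕ} (hn : n = i + l + 2) {t r : ℕ → ℕ}
    (H1 : ∀ p, p < q + 1 → t p < t (q + 1)) (H2 : ∀ p, p < q → t q < t p)
    (H3 : ∀ a b, a < q → b < q → (r a < r b ↔ t a < t b)) :
    Nat.card {w : GW (q + 2) t n // w.1 (i + 1) = n - 1} =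
      Nat.card (GW q r i) * Nat.card (GW (q + 2) t l) := by
  subst hn
  rw [← Nat.card_prod]
  symm
  refine Nat.card_congr
    { toFun := fun p => ⟨⟨glue i l p.1.1 p.2.1, MW_glue p.1.2.1 p.2.2.1, fun h => ?_⟩, ?_⟩
      invFun := fun w => (⟨cutL i l w.1.1, ?_, fun h => ?_⟩, ⟨cutR i w.1.1, ?_, fun h => ?_⟩)
      left_inv := ?_
      right_inv := ?_ }
  · rcases (CW_glue p.1.2.1 p.2.2.1 H1 H2 H3).1 h with h | h
    · exact p.1.2.2 h
    · exact p.2.2.2 h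
  · simp [glue]
  · exact MW_cutL w.1.2.1 w.2
  · apply w.1.2.2
    rw [← glue_cut w.1.2.1 w.2]
    exact (CW_glue (MW_cutL w.1.2.1 w.2) (MW_cutR w.1.2.1 w.2) H1 H2 H3).2 (Or.inl h)
  · exact MW_cutR w.1.2.1 w.2
  · apply w.1.2.2
    rw [← glue_cut w.1.2.1 w.2]
    exact (CW_glue (MW_cutL w.1.2.1 w.2) (MW_cutR w.1.2.1 w.2) H1 H2 H3).2 (Or.inr h)
  · rintro ⟨⟨u, hu, _⟩, ⟨v, hv, _⟩⟩
    refine Prod.ext (Subtype.ext ?_) (Subtype.ext ?_)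
    · funext x
      by_cases hx : x < i
      · simp [cutL, glue, hx]
      · simp [cutL, hx, hu.out x (not_lt.1 hx)]
    · funext x
      simp only [cutR, glue]
      rw [if_neg (by omega), if_neg (by omega), if_neg (by omega)]
      congr 1; omega
  · rintro ⟨w, hw⟩
    exact Subtype.ext (Subtype.ext (glue_cut w.2.1 hw))

/-- Prepend a letter. -/
def pre (m : ℕ) (v : ℕ → ℕ) : ℕ → ℕ
  | 0 => m
  | x + 1 => v x

lemma MW_pre {m : ℕ} {v : ℕ → ℕ} : MW (m + 1) (pre m v) ↔ MW m v := by
  constructor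
  · rintro ⟨w1, w2, w3, w4, w5⟩
    refine ⟨?_, ?_, ?_, ?_, ?_⟩
    · intro x hx
      have h1 := w1 (x + 1) (by omega)
      have h2 := w2 (x + 1) 0 (by omega) (by omega)
      simp only [pre] at h1 h2; omega
    · intro x y hx hy h
      have := w2 (x + 1) (y + 1) (by omega) (by omega) h
      omega
    · intro x hx; exact w3 (x + 1) (by omega)
    · intro x y z h h' hz a b
      exact w4 (x + 1) (y + 1) (z + 1) (by omega) (by omega) (by omega) a b
    · intro x y h hy a b
      exact w5 (x + 1) (y + 1) (by omega) (by omega) a b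
  · rintro ⟨v1, v2, v3, v4, v5⟩
    refine ⟨?_, ?_, ?_, ?_, ?_⟩
    · rintro (_ | x) hx
      · simp [pre]
      · have := v1 x (by omega)
        simp only [pre]; omega
    · rintro (_ | x) (_ | y) hx hy h
      · rfl
      · have := v1 y (by omega)
        simp only [pre] at h; omega
      · have := v1 x (by omega)
        simp only [pre] at h; omega
      · have := v2 x y (by omega) (by omega) h
        omega
    · rintro (_ | x) hx
      · omega
      · exact v3 x (by omega)
    · rintro (_ | x) (_ | y) (_ | z) h h' hz a b <;> try omega
      · have := v1 z (by omega)
        simp only [pre] at a; omega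
      · exact v4 x y z (by omega) (by omega) (by omega) a b
    · rintro (_ | x) (_ | y) h hy a b <;> try omega
      · have := v1 y (by omega)
        simp only [pre] at a; omega
      · exact v5 x y (by omega) (by omega) a b

lemma CW_pre {q m : ℕ} {t v : ℕ → ℕ} (hv : MW m v)
    (H1 : ∀ p, p < q + 1 → t p < t (q + 1)) :
    CW (q + 2) t (m + 1) (pre m v) ↔ CW (q + 2) t m v := by
  constructor
  · rintro ⟨f, f1, f2, f3⟩
    have key : ∀ p, p < q + 2 → f p - 1 + 1 = f p := by
      have h0 : f 0 ≠ 0 := by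
        intro h
        have h1 := (f3 0 (q + 1) (by omega) (by omega)).1 (H1 0 (by omega))
        have h2 := (MW_pre.2 hv).lt _ (f2 (q + 1) (by omega))
        have h3 : pre m v 0 = m := rfl
        rw [h] at h1
        omega
      intro p hp
      rcases Nat.eq_zero_or_pos p with h | h
      · subst h; omega
      · have := f1 0 p h hp
        omega
    refine ⟨fun p => f p - 1, ?_, ?_, ?_⟩
    · intro a b hab hb
      have := f1 a b hab hb
      have := key a (by omega)
      simp only; omega
    · intro a ha
      have := f2 a ha
      have := key a ha
      simp only; omega
    · intro a b ha hb
      rw [f3 a b ha hb, ← key a ha, ← key b hb]; rfl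
  · rintro ⟨f, f1, f2, f3⟩
    refine ⟨fun p => f p + 1, ?_, ?_, ?_⟩
    · intro a b hab hb
      have := f1 a b hab hb
      simp only; omega
    · intro a ha
      have := f2 a ha
      simp only; omega
    · intro a b ha hb
      exact f3 a b ha hb

lemma pre_cut {m : ℕ} {w : ℕ → ℕ} (h : w 0 = m) : pre m (fun x => w (x + 1)) = w := by
  funext x
  cases x with
  | zero => exact h.symm
  | succ x => rfl

lemma card_fib_zero {q m : ℕ} {t : ℕ → ℕ}
    (H1 : ∀ p, p < q + 1 → t p < t (q + 1)) :
    Nat.card {w : GW (q + 2) t (m + 1) // w.1 0 = m} = Nat.card (GW (q + 2) t m) := by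
  symm
  refine Nat.card_congr
    { toFun := fun p => ⟨⟨pre m p.1, MW_pre.2 p.2.1, fun h => p.2.2 ((CW_pre p.2.1 H1).1 h)⟩, rfl⟩
      invFun := fun w => ⟨fun x => w.1.1 (x + 1), ?_, fun h => ?_⟩
      left_inv := fun p => rfl
      right_inv := fun w => Subtype.ext (Subtype.ext (pre_cut w.2)) }
  · apply MW_pre.1
    rw [pre_cut w.2]; exact w.1.2.1
  · apply w.1.2.2
    have hM : MW m (fun x => w.1.1 (x + 1)) := by
      apply MW_pre.1
      rw [pre_cut w.2]; exact w.1.2.1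
    have := (CW_pre hM H1).2 h
    rwa [pre_cut w.2] at this

lemma MW_max {m : ℕ} {w : ℕ → ℕ} (hw : MW (m + 1) w) : ∃ j : Fin (m + 1), w j = m := by
  let g : Fin (m + 1) → Fin (m + 1) := fun x => ⟨w x, hw.lt x x.2⟩
  have hg : Function.Injective g := fun x y h =>
    Fin.ext (hw.inj x y x.2 y.2 (congrArg Fin.val h))
  obtain ⟨j, hj⟩ := (Finite.injective_iff_bijective.1 hg).2 (Fin.last m)
  exact ⟨j, congrArg Fin.val hj⟩

lemma card_split {k m : ℕ} {t : ℕ → ℕ} [Finite (GW k t (m + 1))] :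
    Nat.card (GW k t (m + 1)) =
      ∑ j : Fin (m + 1), Nat.card {w : GW k t (m + 1) // w.1 (j : ℕ) = m} := by
  classical
  choose F hF using fun w : GW k t (m + 1) => MW_max w.2.1
  rw [← Nat.card_congr (Equiv.sigmaFiberEquiv F), Nat.card_sigma]
  refine Finset.sum_congr rfl fun j _ => ?_
  refine Nat.card_congr (Equiv.subtypeEquivRight fun w => ?_)
  constructor
  · rintro rfl; exact hF w
  · intro h
    exact Fin.ext (w.2.1.inj _ _ (F w).2 j.2 ((hF w).trans h.symm))

lemma card_rec {q m : ℕ} {t r : ℕ → ℕ} [Finite (GW (q + 2) t (m + 1))]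
    (H1 : ∀ p, p < q + 1 → t p < t (q + 1)) (H2 : ∀ p, p < q → t q < t p)
    (H3 : ∀ a b, a < q → b < q → (r a < r b ↔ t a < t b)) :
    Nat.card (GW (q + 2) t (m + 1)) = Nat.card (GW (q + 2) t m) +
      ∑ i ∈ Finset.range m, Nat.card (GW q r i) * Nat.card (GW (q + 2) t (m - 1 - i)) := by
  rw [card_split, Fin.sum_univ_succ]
  congr 1
  · exact card_fib_zero H1
  · rw [← Fin.sum_univ_eq_sum_range
      (fun i => Nat.card (GW q r i) * Nat.card (GW (q + 2) t (m - 1 - i)))]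
    refine Finset.sum_congr rfl fun i _ => ?_
    have := i.2
    exact card_fib_succ (n := m + 1) (by omega) H1 H2 H3

lemma card_zero (q : ℕ) (t : ℕ → ℕ) : Nat.card (GW (q + 2) t 0) = 1 := by
  rw [Nat.card_eq_one_iff_unique]
  refine ⟨⟨fun a b => Subtype.ext (funext fun x => ?_)⟩, ⟨fun _ => 0, ?_, ?_⟩⟩
  · rw [a.2.1.out x (Nat.zero_le _), b.2.1.out x (Nat.zero_le _)]
  · refine ⟨?_, ?_, ?_, ?_, ?_⟩ <;> intros <;> omega
  · rintro ⟨f, _, h, _⟩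
    have := h 0 (by omega)
    omega

lemma gf_rec (a b : ℕ → ℚ) (h0 : a 0 = 1)
    (h : ∀ m, a (m + 1) = a m + ∑ i ∈ Finset.range m, b i * a (m - 1 - i)) :
    PowerSeries.mk a * (1 - PowerSeries.X - PowerSeries.X ^ 2 * PowerSeries.mk b) = 1 := by
  have key : PowerSeries.mk a = 1 + PowerSeries.X * (PowerSeries.mk a +
      PowerSeries.X * (PowerSeries.mk b * PowerSeries.mk a)) := by
    ext n
    cases n with
    | zero => simp [h0]
    | succ m =>
      rw [map_add, PowerSeries.coeff_succ_X_mul, map_add, PowerSeries.coeff_mk,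
        PowerSeries.coeff_mk, h m]
      cases m with
      | zero => simp [PowerSeries.coeff_one]
      | succ p =>
        rw [PowerSeries.coeff_succ_X_mul, PowerSeries.coeff_mul,
          Finset.Nat.sum_antidiagonal_eq_sum_range_succ_mk]
        simp [PowerSeries.coeff_one]
  linear_combination key

open PowerSeries in
/-- If `τ = (ρ', 1, k)` is a Motzkin permutation of length `k ≥ 4` and `ρ` is obtained from
`ρ'` by decreasing each entry by 1, then `N_τ(x) (1 - x - x² N_ρ(x)) = 1`.
(Values are 0-indexed: `τ_{k-1} = 1` reads `τ (k-2) = 0` and `τ_k = k` reads `τ (k-1) = k-1`.) -/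
theorem Ngf_tau_rho_one_k (k : ℕ) (hk : 4 ≤ k) (τ : Equiv.Perm (Fin k))
    (hτM : IsMotzkinPerm τ)
    (hτ1 : (τ ⟨k - 2, by omega⟩ : ℕ) = 0)
    (hτ2 : (τ ⟨k - 1, by omega⟩ : ℕ) = k - 1)
    (ρ : Equiv.Perm (Fin (k - 2)))
    (hρ : ∀ i : Fin (k - 2), (ρ i : ℕ) + 1 = (τ ⟨(i : ℕ), by have := i.isLt; omega⟩ : ℕ)) :
    Ngf τ * (1 - X - X ^ 2 * Ngf ρ) = 1 := by
  obtain ⟨q, rfl⟩ : ∃ q, k = q + 2 := ⟨k - 2, by omega⟩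
  have e1 : wd τ q = 0 := by
    have : q < q + 2 := by omega
    simp only [wd, this, dif_pos]
    exact hτ1
  have e2 : wd τ (q + 1) = q + 1 := by
    have : q + 1 < q + 2 := by omega
    simp only [wd, this, dif_pos]
    exact hτ2
  have e3 : ∀ i, i < q → wd ρ i + 1 = wd τ i := by
    intro i hi
    have h1 : i < q + 2 := by omega
    have h2 : i < q + 2 - 2 := by omega
    simp only [wd, h1, h2, dif_pos]
    exact hρ ⟨i, h2⟩
  have hM := (MW_wd τ).2 hτM
  have H1 : ∀ p, p < q + 1 → wd τ p < wd τ (q + 1) := by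
    intro p hp
    have h1 := hM.lt p (by omega)
    have h2 := hM.inj p (q + 1) (by omega) (by omega)
    omega
  have H2 : ∀ p, p < q → wd τ q < wd τ p := by
    intro p hp
    have := e3 p hp
    omega
  have H3 : ∀ a b, a < q → b < q → (wd ρ a < wd ρ b ↔ wd τ a < wd τ b) := by
    intro a b ha hb
    have := e3 a ha
    have := e3 b hb
    omega
  unfold Ngf
  simp only [card_GW]
  apply gf_rec
  · exact_mod_cast card_zero q (wd τ)
  · intro m
    have := card_rec (m := m) H1 H2 H3
    exact_mod_cast this
end

section
/- For every k ≥ 4, let τ = (2,3,…,k−1,1,k), the permutation of [k] whose first k−2 entries are 2,3,…,k−1 followed by 1 and then k. Then N_τ(x)·q_{k−2}(x) = q_{k−3}(x); equivalently N_τ(x) = U_{k−3}((1−x)/(2x)) / (x·U_{k−2}((1−x)/(2x))). -/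
/-- Motzkin trees. -/
inductive MTree where
  | leaf : MTree
  | one : MTree → MTree
  | two : MTree → MTree → MTree

namespace MTree

def size : MTree → ℕ
  | leaf => 0
  | one t => t.size + 1
  | two a b => a.size + b.size + 2

def ht : MTree → ℕ
  | leaf => 0
  | one t => t.ht
  | two a b => max (a.ht + 1) b.ht

/-- The list (one-line notation, values shifted by `s`) encoded by a tree. -/
def toL : MTree → ℕ → List ℕ
  | leaf, _ => []
  | one t, s => (s + t.size) :: t.toL s
  | two a b, s => a.toL (s + b.size + 1) ++ (s + b.size) :: (s + b.size + a.size + 1) :: b.toL s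

theorem toL_perm (t : MTree) : ∀ s, (t.toL s).Perm (List.range' s t.size) := by
  induction t with
  | leaf => intro s; simp [toL, size]
  | one t ih =>
    intro s
    simp only [toL, size, List.range'_concat, one_mul]
    exact ((ih s).cons _).trans (List.perm_append_singleton _ _).symm
  | two a b iha ihb =>
    intro s
    simp only [toL, size]
    have h1 : List.range' s (a.size + b.size + 2) =
        List.range' s b.size ++ ([s + b.size] ++ (List.range' (s + b.size + 1) a.size ++ [s + b.size + a.size + 1])) := by
      have e1 : List.range' (s + b.size + 1) a.size ++ [s + b.size + a.size + 1]
          = List.range' (s + b.size + 1) (a.size + 1) := by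
        rw [List.range'_concat]; congr 2; omega
      have e2 : [s + b.size] ++ List.range' (s + b.size + 1) (a.size + 1)
          = List.range' (s + b.size) (a.size + 2) := by
        rw [List.range'_succ]; rfl
      rw [e1, e2]
      have := List.range'_append_1 (s := s) (m := b.size) (n := a.size + 2)
      rw [this]; congr 1; omega
    rw [h1]
    have h2 := iha (s + b.size + 1)
    have h3 := ihb s
    rw [List.perm_iff_count] at *
    intro x
    have h2 := h2 x
    have h3 := h3 x
    simp only [List.count_append, List.count_cons, List.count_nil] at *
    omega

theorem toL_length (t : MTree) (s : ℕ) : (t.toL s).length = t.size := by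
  simpa using (toL_perm t s).length_eq

theorem toL_nodup (t : MTree) (s : ℕ) : (t.toL s).Nodup :=
  (toL_perm t s).nodup_iff.2 List.nodup_range'

theorem mem_toL (t : MTree) (s x : ℕ) : x ∈ t.toL s ↔ s ≤ x ∧ x < s + t.size := by
  rw [(toL_perm t s).mem_iff, List.mem_range'_1]

theorem toL_inj (t : MTree) : ∀ t' s, t.toL s = t'.toL s → t = t' := by
  induction t with
  | leaf =>
    intro t' s h
    cases t' <;> simp [toL] at h ⊢
  | one t ih =>
    intro t' s h
    have hs : (one t).size = t'.size := by rw [← toL_length _ s, h, toL_length]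
    cases t' with
    | leaf => simp [toL] at h
    | one t' =>
      simp only [toL, List.cons.injEq] at h
      rw [ih _ _ h.2]
    | two a b =>
      exfalso
      simp only [toL, size] at h hs
      have hm := mem_toL a (s + b.size + 1)
      cases hc : a.toL (s + b.size + 1) with
      | nil => rw [hc] at h; simp at h; omega
      | cons x l =>
        rw [hc] at h
        simp only [List.cons_append, List.cons.injEq] at h
        have := (hm x).1 (by simp [hc])
        omega
  | two a b iha ihb =>
    intro t' s h
    have hs : (two a b).size = t'.size := by rw [← toL_length _ s, h, toL_length]
    cases t' with
    | leaf => simp [toL] at h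
    | one t =>
      exfalso
      simp only [toL, size] at h hs
      have hm := mem_toL a (s + b.size + 1)
      cases hc : a.toL (s + b.size + 1) with
      | nil => rw [hc] at h; simp at h; omega
      | cons x l =>
        rw [hc] at h
        simp only [List.cons_append, List.cons.injEq] at h
        have := (hm x).1 (by simp [hc])
        omega
    | two a' b' =>
      simp only [toL, size] at h hs
      have e : s + b'.size + a'.size + 1 = s + b.size + a.size + 1 := by omega
      rw [e] at h
      have h' : (a.toL (s + b.size + 1) ++ [s + b.size]) ++ (s + b.size + a.size + 1) :: b.toL s
        = (a'.toL (s + b'.size + 1) ++ [s + b'.size]) ++ (s + b.size + a.size + 1) :: b'.toL s := by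
        simpa using h
      have hb1 := mem_toL a (s + b.size + 1) (s + b.size + a.size + 1)
      have hb2 := mem_toL a' (s + b'.size + 1) (s + b.size + a.size + 1)
      have hlen : a.size = a'.size := by
        have n1 : (s + b.size + a.size + 1) ∉ a.toL (s + b.size + 1) ++ [s + b.size] := by
          simp only [List.mem_append, List.mem_singleton, mem_toL]; omega
        have n2 : (s + b.size + a.size + 1) ∉ b.toL s := by
          rw [mem_toL]; omega
        have key := (List.append_cons_inj_of_notMem n1 n2).1 h'
        have := congrArg List.length key.1
        simpa [toL_length] using this
      have hlb : b'.size = b.size := by omega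
      rw [hlb] at h
      have := List.append_inj h (by simp [toL_length, hlen])
      simp only [List.cons.injEq, true_and] at this
      rw [iha _ _ this.1, ihb _ _ this.2]

end MTree

/-- 132-avoidance for lists. -/
def LAv132 (l : List ℕ) : Prop :=
  ∀ (i j k : ℕ) (hk : k < l.length) (hij : i < j) (hjk : j < k), ¬ (l[i] < l[k] ∧ l[k] < l[j])

/-- 1-23-avoidance for lists. -/
def LAv123 (l : List ℕ) : Prop :=
  ∀ (a b : ℕ) (hb : b + 1 < l.length) (hab : a < b), ¬ (l[a] < l[b] ∧ l[b] < l[b+1])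

theorem LAv132_append {u v : List ℕ} (hu : LAv132 u) (hv : LAv132 v)
    (huv : ∀ x ∈ u, ∀ y ∈ v, y ≤ x) : LAv132 (u ++ v) := by
  intro i j k hk hij hjk h
  have key : ∀ (i j : ℕ) (hi : i < u.length) (hj : j < v.length), v[j] ≤ u[i] :=
    fun i j hi hj => huv _ (List.getElem_mem _) _ (List.getElem_mem _)
  simp only [List.getElem_append] at h
  simp only [List.length_append] at hk
  split_ifs at h with h1 h2 h3
  all_goals first
    | omega
    | exact hu i j k (by omega) hij hjk h
    | (have := key i (k - u.length) (by omega) (by omega); omega)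
    | exact hv (i - u.length) (j - u.length) (k - u.length) (by omega) (by omega) (by omega) h

theorem LAv123_append {u v : List ℕ} (hu : LAv123 u) (hv : LAv123 v)
    (huv : ∀ x ∈ u, ∀ y ∈ v, y ≤ x) : LAv123 (u ++ v) := by
  intro i j hk hij h
  have key : ∀ (i j : ℕ) (hi : i < u.length) (hj : j < v.length), v[j] ≤ u[i] :=
    fun i j hi hj => huv _ (List.getElem_mem _) _ (List.getElem_mem _)
  simp only [List.getElem_append] at h
  simp only [List.length_append] at hk
  split_ifs at h with h1 h2 h3
  · exact hu i j h3 hij h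
  · have := key j (j + 1 - u.length) h2 (by omega); omega
  · omega
  · have := key i (j - u.length) h1 (by omega); omega
  · omega
  · omega
  · omega
  · have e : j + 1 - u.length = j - u.length + 1 := by omega
    simp only [e] at h
    exact hv (i - u.length) (j - u.length) (by omega) (by omega) h

theorem LAv132_snoc {u : List ℕ} {m : ℕ} (hu : LAv132 u) (h : ∀ x ∈ u, x ≤ m) :
    LAv132 (u ++ [m]) := by
  intro i j k hk hij hjk h'
  have key : ∀ (i : ℕ) (hi : i < u.length), u[i] ≤ m := fun i hi => h _ (List.getElem_mem _)
  simp only [List.length_append, List.length_singleton] at hk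
  by_cases h1 : k < u.length
  · simp only [List.getElem_append] at h'
    rw [dif_pos (by omega), dif_pos (by omega), dif_pos (by omega)] at h'
    exact hu i j k h1 hij hjk h'
  · simp only [List.getElem_append] at h'
    rw [dif_pos (by omega), dif_neg (by omega), dif_pos (by omega)] at h'
    have := key j (by omega)
    simp at h'
    omega

theorem LAv123_snoc {u : List ℕ} {m n : ℕ} (hu : LAv123 (u ++ [m])) (h : ∀ x ∈ u, m ≤ x) :
    LAv123 (u ++ [m] ++ [n]) := by
  intro i j hk hij h'
  have key : ∀ (i : ℕ) (hi : i < u.length), m ≤ u[i] := fun i hi => h _ (List.getElem_mem _)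
  simp only [List.length_append, List.length_singleton] at hk
  by_cases h1 : j < u.length
  · have := hu i j (by simp; omega) hij
    apply this
    rw [List.getElem_append_left (as := u ++ [m]) (i := i) (by rw [List.length_append, List.length_singleton]; omega),
      List.getElem_append_left (as := u ++ [m]) (i := j) (by rw [List.length_append, List.length_singleton]; omega),
      List.getElem_append_left (as := u ++ [m]) (i := j + 1) (by rw [List.length_append, List.length_singleton]; omega)] at h'
    exact h'
  · have e : j = u.length := by omega
    subst e
    have := key i (by omega)
    simp [List.getElem_append] at h'
    rw [dif_pos (by omega)] at h'
    omega

namespace MTree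

theorem toL_two (a b : MTree) (s : ℕ) : (two a b).toL s =
    (a.toL (s + b.size + 1) ++ [s + b.size] ++ [s + b.size + a.size + 1]) ++ b.toL s := by
  simp [toL]

theorem toL_one (t : MTree) (s : ℕ) : (one t).toL s = [s + t.size] ++ t.toL s := by
  simp [toL]

theorem LAv132_single (x : ℕ) : LAv132 [x] := by
  intro i j k hk hij hjk; simp at hk; omega

theorem LAv123_single (x : ℕ) : LAv123 [x] := by
  intro i j hk hij; simp at hk

theorem toL_av132 (t : MTree) : ∀ s, LAv132 (t.toL s) := by
  induction t with
  | leaf => intro s i j k hk; simp [toL] at hk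
  | one t ih =>
    intro s
    rw [toL_one]
    refine LAv132_append (LAv132_single _) (ih s) ?_
    simp only [List.mem_singleton, mem_toL]; omega
  | two a b iha ihb =>
    intro s
    rw [toL_two]
    refine LAv132_append (LAv132_snoc (LAv132_append (iha _) (LAv132_single _) ?_) ?_) (ihb s) ?_
    all_goals simp only [List.mem_append, List.mem_singleton, mem_toL]; omega

theorem toL_av123 (t : MTree) : ∀ s, LAv123 (t.toL s) := by
  induction t with
  | leaf => intro s i j hk; simp [toL] at hk
  | one t ih =>
    intro s
    rw [toL_one]
    refine LAv123_append (LAv123_single _) (ih s) ?_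
    simp only [List.mem_singleton, mem_toL]; omega
  | two a b iha ihb =>
    intro s
    rw [toL_two]
    refine LAv123_append (LAv123_snoc (LAv123_append (iha _) (LAv123_single _) ?_) ?_) (ihb s) ?_
    all_goals simp only [List.mem_append, List.mem_singleton, mem_toL]; omega

end MTree

theorem perm_split {u v : List ℕ} {s n : ℕ} (h : (u ++ v).Perm (List.range' s n))
    (huv : ∀ x ∈ u, ∀ y ∈ v, y < x) :
    v.Perm (List.range' s v.length) ∧ u.Perm (List.range' (s + v.length) u.length) := by
  have hn : n = v.length + u.length := by
    have := h.length_eq; simp at this; omega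
  have hv := List.mergeSort_perm v (· ≤ ·)
  have hu := List.mergeSort_perm u (· ≤ ·)
  have hsv : (v.mergeSort (· ≤ ·)).Pairwise (· ≤ ·) := List.pairwise_mergeSort' (· ≤ ·) v
  have hsu : (u.mergeSort (· ≤ ·)).Pairwise (· ≤ ·) := List.pairwise_mergeSort' (· ≤ ·) u
  have key : v.mergeSort (· ≤ ·) ++ u.mergeSort (· ≤ ·) = List.range' s n := by
    apply List.Perm.eq_of_pairwise (le := (· ≤ ·))
    · intro a b _ _ h1 h2; exact le_antisymm h1 h2
    · rw [List.pairwise_append]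
      refine ⟨hsv, hsu, fun a ha b hb => (huv b (hu.mem_iff.1 hb) a (hv.mem_iff.1 ha)).le⟩
    · exact (List.pairwise_lt_range' (s := s) (n := n)).imp (fun h => le_of_lt h)
    · exact ((hv.append hu).trans List.perm_append_comm).trans h
  rw [hn, ← List.range'_append_1] at key
  have := List.append_inj key (by simp)
  exact ⟨hv.symm.trans (this.1 ▸ List.Perm.refl _), hu.symm.trans (this.2 ▸ List.Perm.refl _)⟩

theorem LAv132.left {u v : List ℕ} (h : LAv132 (u ++ v)) : LAv132 u := by
  intro i j k hk hij hjk h'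
  apply h i j k (by simp; omega) hij hjk
  rw [List.getElem_append_left (by omega), List.getElem_append_left (by omega),
      List.getElem_append_left (by omega)]
  exact h'

theorem LAv132.right {u v : List ℕ} (h : LAv132 (u ++ v)) : LAv132 v := by
  intro i j k hk hij hjk h'
  apply h (u.length + i) (u.length + j) (u.length + k) (by simp; omega) (by omega) (by omega)
  rw [List.getElem_append_right (by omega), List.getElem_append_right (by omega),
      List.getElem_append_right (by omega)]
  simpa using h'

theorem LAv123.left {u v : List ℕ} (h : LAv123 (u ++ v)) : LAv123 u := by
  intro i j hk hij h'
  apply h i j (by simp; omega) hij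
  rw [List.getElem_append_left (by omega), List.getElem_append_left (by omega),
      List.getElem_append_left (by omega)]
  exact h'

theorem LAv123.right {u v : List ℕ} (h : LAv123 (u ++ v)) : LAv123 v := by
  intro i j hk hij h'
  apply h (u.length + i) (u.length + j) (by simp; omega) (by omega)
  rw [List.getElem_append_right (by omega), List.getElem_append_right (by omega),
      List.getElem_append_right (by omega)]
  have e : u.length + j + 1 - u.length = j + 1 := by omega
  simp only [e]
  simpa using h'

theorem exists_tree (n : ℕ) : ∀ (l : List ℕ) (s : ℕ), l.Perm (List.range' s n) → LAv132 l →
    LAv123 l → ∃ t : MTree, t.size = n ∧ t.toL s = l := by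
  induction n using Nat.strong_induction_on with
  | _ n ih =>
  intro l s hp h1 h2
  rcases n with _ | n
  · refine ⟨.leaf, rfl, ?_⟩
    simp at hp
    simp [hp, MTree.toL]
  have hnd : l.Nodup := hp.nodup_iff.2 List.nodup_range'
  have hm : s + n ∈ l := by rw [hp.mem_iff, List.mem_range'_1]; omega
  obtain ⟨u, v, rfl⟩ := List.append_of_mem hm
  have hmem : ∀ x, x ∈ u ∨ x ∈ v → s ≤ x ∧ x < s + n := by
    intro x hx
    have h3 : x ∈ u ++ (s + n) :: v := by simp; tauto
    have h4 := hp.mem_iff.1 h3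
    rw [List.mem_range'_1] at h4
    have h5 : x ≠ s + n := by
      rintro rfl
      rw [List.nodup_middle] at hnd
      simp at hnd
      tauto
    omega
  have hp' : (u ++ v).Perm (List.range' s n) := by
    have h6 := List.perm_middle.symm.trans hp
    rw [List.range'_concat, one_mul] at h6
    exact (h6.trans (List.perm_append_singleton _ _)).cons_inv
  have hnd' := hp'.nodup_iff.2 List.nodup_range'
  have huv : ∀ x ∈ u, ∀ y ∈ v, y < x := by
    intro x hx y hy
    obtain ⟨i, hi, rfl⟩ := List.getElem_of_mem hx
    obtain ⟨j, hj, rfl⟩ := List.getElem_of_mem hy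
    by_contra hc
    have hne : u[i] ≠ v[j] := (List.nodup_append.1 hnd').2.2 _ hx _ hy
    apply h1 i u.length (u.length + 1 + j) (by simp; omega) hi (by omega)
    have e : u.length + 1 + j - u.length = j + 1 := by omega
    rw [List.getElem_append_left hi, List.getElem_append_right (by omega), List.getElem_append_right (by omega)]
    simp only [e, Nat.sub_self, List.getElem_cons_zero, List.getElem_cons_succ]
    have := hmem _ (Or.inr hy)
    omega
  obtain ⟨hpv, hpu⟩ := perm_split hp' huv
  have hlen : u.length + v.length = n := by simpa using hp'.length_eq
  have h1v : LAv132 v := LAv132.right (u := u ++ [s + n]) (by simpa using h1)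
  have h2v : LAv123 v := LAv123.right (u := u ++ [s + n]) (by simpa using h2)
  obtain ⟨b, hb, hbv⟩ := ih v.length (by omega) v s hpv h1v h2v
  rcases List.eq_nil_or_concat' u with rfl | ⟨u', m, rfl⟩
  · refine ⟨.one b, ?_, ?_⟩
    · simp at hlen; simp [MTree.size]; omega
    · simp at hlen; simp [MTree.toL, hbv]; omega
  · simp only [List.length_append, List.length_singleton] at hlen
    have hu'm : ∀ x ∈ u', ∀ y ∈ [m], y < x := by
      intro x hx y hy
      simp only [List.mem_singleton] at hy
      subst hy
      have hne : x ≠ y := by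
        have := (List.nodup_append.1 (List.nodup_append.1 hnd').1).2.2 x hx y (by simp)
        exact this
      by_contra hc
      obtain ⟨i, hi, rfl⟩ := List.getElem_of_mem hx
      apply h2 i u'.length (by simp) hi
      have := hmem y (by simp)
      simp [hi]
      omega
    obtain ⟨hpm, hpu'⟩ := perm_split hpu hu'm
    simp at hpm
    simp only [List.length_singleton] at hpu'
    obtain ⟨a, ha, hau⟩ := ih u'.length (by omega) u' _ hpu' (by
      exact LAv132.left (LAv132.left h1)) (by exact LAv123.left (LAv123.left h2))
    refine ⟨.two a b, ?_, ?_⟩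
    · simp [MTree.size]; omega
    · simp only [MTree.toL, hb, ha, hau, hbv, hpm]
      simp; omega


/-- The list contains an increasing subsequence of length `p`. -/
def HasInc (p : ℕ) (l : List ℕ) : Prop :=
  ∃ w : List ℕ, w.Sublist l ∧ w.Pairwise (· < ·) ∧ w.length = p

/-- The list contains the pattern `2 3 … (p+1) 1 (p+2)`. -/
def HasTau (p : ℕ) (l : List ℕ) : Prop :=
  ∃ (w : List ℕ) (a b : ℕ), (w ++ [a, b]).Sublist l ∧ w.Pairwise (· < ·) ∧ w.length = p ∧
    ∀ x ∈ w, a < x ∧ x < b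

theorem HasInc.mono {p : ℕ} {u v : List ℕ} (h : HasInc p u) (huv : u.Sublist v) : HasInc p v := by
  obtain ⟨w, h1, h2⟩ := h
  exact ⟨w, h1.trans huv, h2⟩

theorem HasTau.mono {p : ℕ} {u v : List ℕ} (h : HasTau p u) (huv : u.Sublist v) : HasTau p v := by
  obtain ⟨w, a, b, h1, h2⟩ := h
  exact ⟨w, a, b, h1.trans huv, h2⟩

theorem HasInc.le {p : ℕ} {u : List ℕ} (h : HasInc p u) : p ≤ u.length := by
  obtain ⟨w, h1, h2, rfl⟩ := h
  exact h1.length_le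

theorem HasTau.le {p : ℕ} {u : List ℕ} (h : HasTau p u) : p + 2 ≤ u.length := by
  obtain ⟨w, a, b, h1, h2, rfl, _⟩ := h
  simpa using h1.length_le

theorem HasInc_append {p : ℕ} {u v : List ℕ} (huv : ∀ x ∈ u, ∀ y ∈ v, y < x) :
    HasInc p (u ++ v) ↔ HasInc p u ∨ HasInc p v := by
  constructor
  · rintro ⟨w, h1, h2, h3⟩
    obtain ⟨w1, w2, rfl, hs1, hs2⟩ := List.sublist_append_iff.1 h1
    rcases w1 with _ | ⟨x, w1⟩
    · exact Or.inr ⟨w2, hs2, by simpa using h2, by simpa using h3⟩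
    rcases w2 with _ | ⟨y, w2⟩
    · exact Or.inl ⟨x :: w1, hs1, by simpa using h2, by simpa using h3⟩
    exfalso
    have h4 := (List.pairwise_append.1 h2).2.2 x (by simp) y (by simp)
    have h5 := huv x (hs1.subset (by simp)) y (hs2.subset (by simp))
    omega
  · rintro (h | h)
    · exact h.mono (List.sublist_append_left _ _)
    · exact h.mono (List.sublist_append_right _ _)

theorem HasInc_snoc {p n : ℕ} {u : List ℕ} (hu : ∀ x ∈ u, x < n) :
    HasInc (p + 1) (u ++ [n]) ↔ HasInc p u := by
  constructor
  · rintro ⟨w, h1, h2, h3⟩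
    obtain ⟨w1, w2, rfl, hs1, hs2⟩ := List.sublist_append_iff.1 h1
    have h4 := hs2.length_le
    simp only [List.length_append, List.length_singleton] at h3 h4
    refine ⟨w1.take p, (List.take_sublist _ _).trans hs1, ?_, by simp; omega⟩
    exact ((List.pairwise_append.1 h2).1).sublist (List.take_sublist _ _)
  · rintro ⟨w, h1, h2, h3⟩
    refine ⟨w ++ [n], h1.append (List.Sublist.refl _), ?_, by simp [h3]⟩
    rw [List.pairwise_append]
    refine ⟨h2, by simp, ?_⟩
    intro x hx y hy
    simp only [List.mem_singleton] at hy
    subst hy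
    exact hu x (h1.subset hx)

theorem HasTau_append {p : ℕ} (hp : 1 ≤ p) {u v : List ℕ} (huv : ∀ x ∈ u, ∀ y ∈ v, y < x) :
    HasTau p (u ++ v) ↔ HasTau p u ∨ HasTau p v := by
  constructor
  · rintro ⟨w, a, b, h1, h2, h3, h4⟩
    obtain ⟨c1, c2, hc, hs1, hs2⟩ := List.sublist_append_iff.1 h1
    rcases List.eq_nil_or_concat' c2 with rfl | ⟨c2, y, rfl⟩
    · left
      refine ⟨w, a, b, ?_, h2, h3, h4⟩
      rw [hc]; simpa using hs1
    rcases c1 with _ | ⟨x, c1⟩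
    · right
      refine ⟨w, a, b, ?_, h2, h3, h4⟩
      rw [hc]; simpa using hs2
    exfalso
    rcases w with _ | ⟨z, w⟩
    · simp at h3; omega
    have hz : z = x := by simp at hc; exact hc.1
    have hb : b = y := by
      have := congrArg List.getLast? hc
      rw [← List.append_assoc] at this
      rw [show z :: w ++ [a, b] = (z :: w ++ [a]) ++ [b] by simp] at this
      rw [List.getLast?_concat, List.getLast?_concat] at this
      simpa using this
    have h5 := huv x (hs1.subset (by simp)) y (hs2.subset (by simp))
    have h6 := h4 z (by simp)
    omega
  · rintro (h | h)
    · exact h.mono (List.sublist_append_left _ _)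
    · exact h.mono (List.sublist_append_right _ _)

theorem HasTau_snoc {p m n : ℕ} {u : List ℕ} (hm : ∀ x ∈ u, m < x) (hn : ∀ x ∈ u, x < n) :
    HasTau p (u ++ [m] ++ [n]) ↔ HasInc p u := by
  constructor
  · rintro ⟨w, a, b, h1, h2, h3, h4⟩
    rw [List.append_assoc] at h1
    obtain ⟨c1, c2, hc, hs1, hs2⟩ := List.sublist_append_iff.1 h1
    have h5 := hs2.length_le
    have h6 := congrArg List.length hc
    simp at h5 h6
    have h7 : w = c1.take p := by
      have := congrArg (List.take p) hc
      rw [List.take_append_of_le_length (by omega), List.take_append_of_le_length (by omega),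
        List.take_of_length_le (by omega)] at this
      exact this
    refine ⟨w, ?_, h2, h3⟩
    rw [h7]
    exact (List.take_sublist _ _).trans hs1
  · rintro ⟨w, h1, h2, h3⟩
    refine ⟨w, m, n, ?_, h2, h3, fun x hx => ⟨hm x (h1.subset hx), hn x (h1.subset hx)⟩⟩
    rw [List.append_assoc]
    exact h1.append (List.Sublist.refl _)

namespace MTree

theorem hasInc_iff (t : MTree) : ∀ (s j : ℕ), 1 ≤ j → (HasInc (j + 1) (t.toL s) ↔ j ≤ t.ht) := by
  induction t with
  | leaf =>
    intro s j hj
    simp only [toL, ht]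
    constructor
    · intro h; have := h.le; simp at this
    · intro h; omega
  | one t ih =>
    intro s j hj
    rw [toL_one, HasInc_append (by simp only [List.mem_singleton, mem_toL]; omega), ih s j hj]
    simp only [ht]
    constructor
    · rintro (h | h)
      · have := h.le; simp at this; omega
      · exact h
    · exact Or.inr
  | two a b iha ihb =>
    intro s j hj
    rw [toL_two, HasInc_append
      (by simp only [List.mem_append, List.mem_singleton, mem_toL]; omega), ihb s j hj,
      HasInc_snoc (by simp only [List.mem_append, List.mem_singleton, mem_toL]; omega),
      HasInc_append (by simp only [List.mem_singleton, mem_toL]; omega)]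
    simp only [ht]
    rcases j with _ | _ | j
    · omega
    · have : HasInc 1 [s + b.size] := ⟨[s + b.size], List.Sublist.refl _, by simp, rfl⟩
      simp [this]
    · rw [iha _ (j + 1) (by omega)]
      have : ¬ HasInc (j + 1 + 1) [s + b.size] := by
        intro h; have := h.le; simp at this
      simp [this]

theorem hasTau_iff (t : MTree) (p : ℕ) (hp : 2 ≤ p) : ∀ (s : ℕ), HasTau p (t.toL s) ↔ p ≤ t.ht := by
  induction t with
  | leaf =>
    intro s
    simp only [toL, ht]
    constructor
    · intro h; have := h.le; simp at this
    · intro h; omega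
  | one t ih =>
    intro s
    rw [toL_one, HasTau_append (by omega) (by simp only [List.mem_singleton, mem_toL]; omega), ih s]
    simp only [ht]
    constructor
    · rintro (h | h)
      · have := h.le; simp at this
      · exact h
    · exact Or.inr
  | two a b iha ihb =>
    intro s
    rw [toL_two, HasTau_append (by omega)
      (by simp only [List.mem_append, List.mem_singleton, mem_toL]; omega), ihb s,
      HasTau_snoc (by simp only [mem_toL]; omega) (by simp only [mem_toL]; omega)]
    obtain ⟨q, rfl⟩ : ∃ q, p = q + 1 := ⟨p - 1, by omega⟩
    rw [hasInc_iff a _ q (by omega)]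
    simp [ht]

open Classical in
/-- All trees of size `n` and height at most `r`. -/
noncomputable def trees : ℕ → ℕ → Finset MTree
  | _, 0 => {leaf}
  | _, 1 => {one leaf}
  | r, n + 2 => (trees r (n + 1)).image one ∪
      (if _h : r = 0 then ∅ else (Finset.HasAntidiagonal.antidiagonal n).attach.biUnion fun p =>
        have := Finset.HasAntidiagonal.mem_antidiagonal.1 p.2
        Finset.image₂ two (trees (r - 1) p.1.1) (trees r p.1.2))
  termination_by _ n => n
  decreasing_by all_goals omega

end MTree

namespace MTree

theorem mem_trees (n : ℕ) : ∀ (r : ℕ) (t : MTree), t ∈ trees r n ↔ t.size = n ∧ t.ht ≤ r := by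
  induction n using Nat.strong_induction_on with
  | _ n ih =>
  intro r t
  rcases n with _ | _ | n
  · rw [trees]; cases t <;> simp [size, ht]
  · rw [trees]
    cases t with
    | leaf => simp [size]
    | one t => cases t <;> simp [size, ht]
    | two a b => simp [size]
  · rw [trees]
    cases t with
    | leaf =>
      simp only [size, Finset.mem_union, Finset.mem_image]
      split_ifs <;> simp
    | one t =>
      simp only [size, Finset.mem_union, Finset.mem_image, ht]
      have := ih (n + 1) (by omega) r t
      split_ifs <;> simp [this]
    | two a b =>
      simp only [size, Finset.mem_union, Finset.mem_image, ht]
      split_ifs with h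
      · simp; omega
      · simp only [Finset.mem_biUnion, Finset.mem_image₂, Finset.mem_attach, true_and,
          and_false, exists_false, false_or]
        constructor
        · rintro ⟨⟨⟨p, q⟩, hpq⟩, a', ha, b', hb, hab⟩
          rw [Finset.HasAntidiagonal.mem_antidiagonal] at hpq
          simp only [two.injEq] at hab
          obtain ⟨rfl, rfl⟩ := hab
          simp only at ha hb hpq
          rw [ih _ (by omega)] at ha hb
          omega
        · rintro ⟨h1, h2⟩
          refine ⟨⟨⟨a.size, b.size⟩, by rw [Finset.HasAntidiagonal.mem_antidiagonal]; simp only; omega⟩, a, ?_, b, ?_, rfl⟩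
          · refine (ih _ (by simp only; omega) _ _).2 ⟨rfl, by omega⟩
          · refine (ih _ (by simp only; omega) _ _).2 ⟨rfl, by omega⟩

theorem card_trees_zero (n : ℕ) : (trees 0 (n + 2)).card = (trees 0 (n + 1)).card := by
  classical
  rw [trees]
  simp only [dite_true, Finset.union_empty]
  rw [Finset.card_image_of_injective]
  intro a b h; simpa using h

theorem card_trees_succ (r n : ℕ) : (trees (r + 1) (n + 2)).card = (trees (r + 1) (n + 1)).card +
    ∑ p ∈ Finset.HasAntidiagonal.antidiagonal n, (trees r p.1).card * (trees (r + 1) p.2).card := by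
  classical
  rw [trees, dif_neg (by omega), Finset.card_union_of_disjoint]
  · congr 1
    · rw [Finset.card_image_of_injective]
      intro a b h; simpa using h
    · rw [Finset.card_biUnion]
      · rw [← Finset.sum_attach (Finset.HasAntidiagonal.antidiagonal n)]
        apply Finset.sum_congr rfl
        intro p _
        rw [Finset.card_image₂]
        · rfl
        · intro a b; simp
      · rintro ⟨⟨p, q⟩, h⟩ _ ⟨⟨p', q'⟩, h'⟩ _ hne
        simp only [ne_eq, Subtype.mk.injEq, Prod.mk.injEq] at hne
        rw [Function.onFun_apply, Finset.disjoint_left]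
        intro t ht ht'
        simp only [Finset.mem_image₂, mem_trees] at ht ht'
        obtain ⟨a, ha, b, hb, rfl⟩ := ht
        obtain ⟨a', ha', b', hb', h2⟩ := ht'
        simp only [two.injEq] at h2
        obtain ⟨rfl, rfl⟩ := h2
        omega
  · rw [Finset.disjoint_left]
    intro t ht ht'
    simp only [Finset.mem_image, Finset.mem_biUnion, Finset.mem_image₂] at ht ht'
    obtain ⟨a, _, rfl⟩ := ht
    obtain ⟨_, _, _, _, _, _, h⟩ := ht'
    simp at h

/-- generating function of trees of height at most `r` -/
noncomputable def G (r : ℕ) : PowerSeries ℚ := PowerSeries.mk fun n => ((trees r n).card : ℚ)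

theorem G_zero : G 0 = 1 + PowerSeries.X * G 0 := by
  ext n
  rcases n with _ | _ | n
  · simp [G, trees]
  · rw [map_add, PowerSeries.coeff_succ_X_mul]
    simp [G, trees, PowerSeries.coeff_one]
  · rw [map_add, PowerSeries.coeff_succ_X_mul]
    simp [G, card_trees_zero, PowerSeries.coeff_one]

theorem G_succ (r : ℕ) : G (r + 1) = 1 + PowerSeries.X * (G (r + 1) + PowerSeries.X * (G r * G (r + 1))) := by
  ext n
  rcases n with _ | _ | n
  · simp [G, trees]
  · rw [map_add, PowerSeries.coeff_succ_X_mul]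
    simp [G, trees, PowerSeries.coeff_one]
  · rw [map_add, PowerSeries.coeff_succ_X_mul, map_add, PowerSeries.coeff_succ_X_mul,
      PowerSeries.coeff_mul]
    simp [G, card_trees_succ, PowerSeries.coeff_one]

theorem G_qcheb (r : ℕ) : G r * qcheb (r + 2) = qcheb (r + 1) := by
  induction r with
  | zero =>
    simp only [qcheb]
    linear_combination G_zero
  | succ r ih =>
    have e : qcheb (r + 1 + 2) = (1 - PowerSeries.X) * qcheb (r + 2) - PowerSeries.X ^ 2 * qcheb (r + 1) := by
      rw [qcheb]
    rw [e, ← ih]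
    linear_combination (qcheb (r + 2)) * G_succ r

end MTree

/-- One-line notation of a permutation. -/
def permL {n : ℕ} (π : Equiv.Perm (Fin n)) : List ℕ := List.ofFn fun i => (π i : ℕ)

theorem permL_length {n : ℕ} (π : Equiv.Perm (Fin n)) : (permL π).length = n := by simp [permL]

theorem permL_getElem {n : ℕ} (π : Equiv.Perm (Fin n)) (i : ℕ) (hi : i < (permL π).length) :
    (permL π)[i] = (π ⟨i, by simpa [permL] using hi⟩ : ℕ) := by simp [permL]

theorem permL_injective {n : ℕ} : Function.Injective (permL (n := n)) := by
  intro π σ h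
  have := List.ofFn_injective h
  ext i
  exact congrFun this i

theorem permL_perm {n : ℕ} (π : Equiv.Perm (Fin n)) : (permL π).Perm (List.range' 0 n) := by
  have hnd : (permL π).Nodup := by
    unfold permL
    rw [List.nodup_ofFn]
    intro i j h
    exact π.injective (Fin.ext h)
  rw [List.perm_ext_iff_of_nodup hnd List.nodup_range']
  intro x
  simp only [permL, List.mem_ofFn, List.mem_range'_1]
  constructor
  · rintro ⟨i, rfl⟩; have := (π i).2; simp
  · rintro ⟨_, h⟩
    exact ⟨π.symm ⟨x, by omega⟩, by simp⟩

theorem exists_permL {n : ℕ} (l : List ℕ) (h : l.Perm (List.range' 0 n)) :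
    ∃ π : Equiv.Perm (Fin n), permL π = l := by
  have hl : l.length = n := by simpa using h.length_eq
  have hnd : l.Nodup := h.nodup_iff.2 List.nodup_range'
  have hlt : ∀ (i : ℕ) (hi : i < l.length), l[i] < n := by
    intro i hi
    have := h.mem_iff.1 (List.getElem_mem hi)
    rw [List.mem_range'_1] at this
    omega
  let f : Fin n → Fin n := fun i => ⟨l[i.1]'(by omega), hlt _ _⟩
  have hf : Function.Injective f := by
    intro i j hij
    simp only [f, Fin.mk.injEq] at hij
    exact Fin.ext ((hnd.getElem_inj_iff).1 hij)
  refine ⟨Equiv.ofBijective f (Finite.injective_iff_bijective.1 hf), ?_⟩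
  apply List.ext_getElem
  · rw [permL_length, hl]
  · intro i h1 h2
    rw [permL_getElem]
    simp [f]

theorem motzkin_iff {n : ℕ} (π : Equiv.Perm (Fin n)) :
    IsMotzkinPerm π ↔ LAv132 (permL π) ∧ LAv123 (permL π) := by
  unfold IsMotzkinPerm
  apply and_congr
  · unfold Avoids132 LAv132
    constructor
    · intro h i j k hk hij hjk h'
      simp only [permL_getElem] at h'
      rw [permL_length] at hk
      exact h ⟨⟨i, by omega⟩, ⟨j, by omega⟩, ⟨k, hk⟩, hij, hjk, h'.1, h'.2⟩
    · rintro h ⟨i, j, k, hij, hjk, h1, h2⟩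
      apply h i j k (by rw [permL_length]; exact k.2) hij hjk
      simp only [permL_getElem]
      exact ⟨h1, h2⟩
  · unfold Avoids1_23 LAv123
    constructor
    · intro h i j hk hij h'
      simp only [permL_getElem] at h'
      rw [permL_length] at hk
      exact h ⟨⟨i, by omega⟩, ⟨j, by omega⟩, hk, hij, h'.1, h'.2⟩
    · rintro h ⟨i, j, hk, hij, h1, h2⟩
      apply h i j (by rw [permL_length]; exact hk) hij
      simp only [permL_getElem]
      exact ⟨h1, h2⟩

theorem contains_iff (p : ℕ) (τ : Equiv.Perm (Fin (p + 2)))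
    (hτ0 : ∀ i : Fin (p + 2), (i : ℕ) < p → (τ i : ℕ) = (i : ℕ) + 1)
    (hτ1 : ∀ i : Fin (p + 2), (i : ℕ) = p → (τ i : ℕ) = 0)
    (hτ2 : ∀ i : Fin (p + 2), (i : ℕ) = p + 1 → (τ i : ℕ) = p + 1)
    (hp : 1 ≤ p) {n : ℕ} (π : Equiv.Perm (Fin n)) :
    ContainsPatt τ π ↔ HasTau p (permL π) := by
  constructor
  · rintro ⟨f, hf, h⟩
    refine ⟨List.ofFn (fun i : Fin p => (π (f ⟨i, by omega⟩) : ℕ)), π (f ⟨p, by omega⟩),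
      π (f ⟨p + 1, by omega⟩), ?_, ?_, by simp, ?_⟩
    · have e : (List.ofFn (fun i : Fin p => (π (f ⟨i, by omega⟩) : ℕ))) ++ [(π (f ⟨p, by omega⟩) : ℕ),
        (π (f ⟨p + 1, by omega⟩) : ℕ)] = List.ofFn (fun i => (π (f i) : ℕ)) := by
        rw [List.ofFn_succ_last, List.ofFn_succ_last]
        simp [Fin.last]
        rfl
      rw [e, List.sublist_iff_exists_fin_orderEmbedding_get_eq]
      refine ⟨OrderEmbedding.ofStrictMono (fun i => Fin.cast (permL_length π).symm (f (Fin.cast (by simp) i))) ?_, ?_⟩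
      · intro i j hij
        exact hf hij
      · intro i
        simp only [List.get_eq_getElem, permL_getElem, List.getElem_ofFn]
        rfl
    · rw [List.pairwise_ofFn]
      intro i j hij
      apply (h _ _).1
      rw [Fin.lt_def, hτ0 _ (by simp), hτ0 _ (by simp)]
      simpa using hij
    · intro x hx
      rw [List.mem_ofFn] at hx
      obtain ⟨i, rfl⟩ := hx
      constructor
      · apply (h _ _).1
        rw [Fin.lt_def, hτ0 ⟨i, _⟩ (by simp), hτ1 _ rfl]
        omega
      · apply (h _ _).1
        rw [Fin.lt_def, hτ0 ⟨i, _⟩ (by simp), hτ2 _ rfl]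
        simp
  · rintro ⟨w, a, b, hs, hw, hlen, hab⟩
    obtain ⟨f, hf⟩ := List.sublist_iff_exists_fin_orderEmbedding_get_eq.1 hs
    have hcl : (w ++ [a, b]).length = p + 2 := by simp [hlen]
    have hmono : ∀ (i j : ℕ) (hi : i < w.length) (hj : j < w.length), i < j → w[i] < w[j] :=
      fun i j hi hj hij => List.pairwise_iff_getElem.1 hw i j hi hj hij
    have hab' : ∀ (i : ℕ) (hi : i < w.length), a < w[i] ∧ w[i] < b :=
      fun i hi => hab _ (List.getElem_mem _)
    have hab0 : a < b := by have := hab' 0 (by omega); omega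
    refine ⟨fun i => Fin.cast (permL_length π) (f (Fin.cast hcl.symm i)), ?_, ?_⟩
    · intro i j hij
      have : f (Fin.cast hcl.symm i) < f (Fin.cast hcl.symm j) := f.strictMono hij
      exact this
    · have hv : ∀ i : Fin (p + 2), (π (Fin.cast (permL_length π) (f (Fin.cast hcl.symm i))) : ℕ)
          = (w ++ [a, b])[i.1]'(by omega) := by
        intro i
        have := hf (Fin.cast hcl.symm i)
        simp only [List.get_eq_getElem, permL_getElem] at this
        exact this.symm
      have c1 : ∀ i : Fin (p + 2), ∀ (h : i.1 < p), (w ++ [a, b])[i.1]'(by omega) = w[i.1]'(by omega) := by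
        intro i h
        rw [List.getElem_append_left]
      have c2 : ∀ i : Fin (p + 2), i.1 = p → (w ++ [a, b])[i.1]'(by omega) = a := by
        intro i h
        simp [h, ← hlen]
      have c3 : ∀ i : Fin (p + 2), i.1 = p + 1 → (w ++ [a, b])[i.1]'(by omega) = b := by
        intro i h
        simp [h, ← hlen]
      intro i j
      rw [Fin.lt_def, Fin.lt_def, hv, hv]
      have hi : i.1 < p ∨ i.1 = p ∨ i.1 = p + 1 := by omega
      have hj : j.1 < p ∨ j.1 = p ∨ j.1 = p + 1 := by omega
      rcases hi with hi | hi | hi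
      · rw [hτ0 i hi, c1 i hi]
        have h1 := hab' i.1 (by omega)
        rcases hj with hj | hj | hj
        · rw [hτ0 j hj, c1 j hj]
          rcases lt_trichotomy i.1 j.1 with h | h | h
          · have := hmono i.1 j.1 (by omega) (by omega) h; omega
          · simp [h]
          · have := hmono j.1 i.1 (by omega) (by omega) h; omega
        · rw [hτ1 j hj, c2 j hj]; omega
        · rw [hτ2 j hj, c3 j hj]; omega
      · rw [hτ1 i hi, c2 i hi]
        rcases hj with hj | hj | hj
        · rw [hτ0 j hj, c1 j hj]; have h1 := hab' j.1 (by omega); omega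
        · rw [hτ1 j hj, c2 j hj]; omega
        · rw [hτ2 j hj, c3 j hj]; omega
      · rw [hτ2 i hi, c3 i hi]
        rcases hj with hj | hj | hj
        · rw [hτ0 j hj, c1 j hj]; have h1 := hab' j.1 (by omega); omega
        · rw [hτ1 j hj, c2 j hj]; omega
        · rw [hτ2 j hj, c3 j hj]; omega

theorem card_eq (r n : ℕ) (P : Equiv.Perm (Fin n) → Prop) (hr : 1 ≤ r)
    (hP : ∀ π, P π ↔ HasTau (r + 1) (permL π)) :
    Nat.card {π : Equiv.Perm (Fin n) // IsMotzkinPerm π ∧ ¬ P π} = (MTree.trees r n).card := by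
  have e : permL '' {π : Equiv.Perm (Fin n) | IsMotzkinPerm π ∧ ¬ P π} =
      (fun t : MTree => t.toL 0) '' (MTree.trees r n : Set MTree) := by
    ext l
    simp only [Set.mem_image, Set.mem_ofPred_eq, Finset.mem_coe, MTree.mem_trees]
    constructor
    · rintro ⟨π, ⟨h1, h2⟩, rfl⟩
      rw [motzkin_iff] at h1
      obtain ⟨t, ht, hl⟩ := exists_tree n _ 0 (permL_perm π) h1.1 h1.2
      refine ⟨t, ⟨ht, ?_⟩, hl⟩
      rw [hP, ← hl, MTree.hasTau_iff _ _ (by omega)] at h2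
      omega
    · rintro ⟨t, ⟨ht, hr'⟩, rfl⟩
      have hp := MTree.toL_perm t 0
      rw [ht] at hp
      obtain ⟨π, hπ⟩ := exists_permL _ hp
      refine ⟨π, ⟨?_, ?_⟩, hπ⟩
      · rw [motzkin_iff, hπ]
        exact ⟨MTree.toL_av132 t 0, MTree.toL_av123 t 0⟩
      · rw [hP, hπ, MTree.hasTau_iff _ _ (by omega)]
        omega
  have h1 := Set.ncard_image_of_injective {π : Equiv.Perm (Fin n) | IsMotzkinPerm π ∧ ¬ P π}
    permL_injective
  have h2 := Set.ncard_image_of_injective (MTree.trees r n : Set MTree)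
    (f := fun t : MTree => t.toL 0) (fun t t' h => MTree.toL_inj t t' 0 h)
  rw [e, h2, Set.ncard_coe_finset] at h1
  rw [h1]
  exact Nat.card_coe_set_eq _

/-- For `τ = 23…(k-1)1k` (values 0-indexed: `τ i = i + 1` for `i < k-2`, `τ (k-2) = 0`,
`τ (k-1) = k-1`) one has `N_τ(x) q_{k-2}(x) = q_{k-3}(x)`, i.e.
`N_τ(x) = U_{k-3}((1-x)/(2x)) / (x U_{k-2}((1-x)/(2x)))`. -/
theorem Ngf_23_to_km1_1_k (k : ℕ) (hk : 4 ≤ k) (τ : Equiv.Perm (Fin k))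
    (hτ0 : ∀ i : Fin k, (i : ℕ) < k - 2 → (τ i : ℕ) = (i : ℕ) + 1)
    (hτ1 : (τ ⟨k - 2, by omega⟩ : ℕ) = 0)
    (hτ2 : (τ ⟨k - 1, by omega⟩ : ℕ) = k - 1) :
    Ngf τ * qcheb (k - 1) = qcheb (k - 2) := by
  obtain ⟨p, rfl⟩ : ∃ p, k = p + 4 := ⟨k - 4, by omega⟩
  have key : Ngf τ = MTree.G (p + 1) := by
    unfold Ngf MTree.G
    congr 1
    funext n
    rw [card_eq (p + 1) n _ (by omega) (fun π => contains_iff (p + 2) τ ?_ ?_ ?_ (by omega) π)]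
    · intro i hi
      exact hτ0 i (by omega)
    · intro i hi
      rw [← hτ1]
      congr 2
      ext; simp [hi]
    · intro i hi
      have e : i = ⟨p + 4 - 1, by omega⟩ := by ext; simp [hi]
      rw [e, hτ2]
      omega
  rw [key]
  exact MTree.G_qcheb (p + 1)
end

section
/- For every k ≥ 1: (a) letting σ be the permutation (k, k+1, k−1, k+2, k−2, k+3, …, 1, 2k) of [2k], one has N_σ(x)·q_k(x) = q_{k−1}(x); and (b) letting τ be the permutation (k+1, k, k+2, k−1, k+3, k−2, …, 1, 2k+1) of [2k+1], one has N_τ(x)·(q_{k+1}(x) + x·q_k(x)) = q_k(x) + x·q_{k−1}(x). Equivalently, N_σ(x) = U_{k−1}(s)/(x U_k(s)) and N_τ(x) = (U_k(s)+U_{k−1}(s))/(x(U_{k+1}(s)+U_k(s))) with s = (1−x)/(2x). -/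
def LA132 (w : List ℕ) : Prop := ∀ a b c, [a, b, c].Sublist w → a < c → c < b → False

def LA123 (w : List ℕ) : Prop :=
  ∀ u b c v, w = u ++ b :: c :: v → ∀ a ∈ u, a < b → b < c → False

def Zig (b : ℕ) : ℕ → List ℕ → Prop
  | 0, s => s.length = b
  | k + 1, s => ∃ s' a m, s = s' ++ [a, m] ∧ Zig b k s' ∧ (∀ x ∈ s', a < x ∧ x < m) ∧ a < m

def HasZig (b k : ℕ) (w : List ℕ) : Prop := ∃ s, Zig b k s ∧ s.Sublist w

def IsSeg (n o : ℕ) (w : List ℕ) : Prop := w.Nodup ∧ ∀ x, x ∈ w ↔ o ≤ x ∧ x < o + n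

def Good (b k n o : ℕ) (w : List ℕ) : Prop :=
  IsSeg n o w ∧ LA132 w ∧ LA123 w ∧ ¬ HasZig b k w

theorem sub3_append (a b c : ℕ) (l r : List ℕ) (h : [a, b, c].Sublist (l ++ r)) :
    [a, b, c].Sublist l ∨ ([a, b].Sublist l ∧ c ∈ r) ∨ (a ∈ l ∧ [b, c].Sublist r) ∨
      [a, b, c].Sublist r := by
  rw [List.sublist_append_iff] at h
  obtain ⟨l1, l2, h, h1, h2⟩ := h
  rcases l1 with _ | ⟨x, _ | ⟨y, _ | ⟨z, _ | ⟨t, l1⟩⟩⟩⟩ <;> simp at h <;> try grind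

theorem sub2_append (a b : ℕ) (l r : List ℕ) (h : [a, b].Sublist (l ++ r)) :
    [a, b].Sublist l ∨ (a ∈ l ∧ b ∈ r) ∨ [a, b].Sublist r := by
  rw [List.sublist_append_iff] at h
  obtain ⟨l1, l2, h, h1, h2⟩ := h
  rcases l1 with _ | ⟨x, _ | ⟨y, _ | ⟨z, l1⟩⟩⟩ <;> simp at h <;> try grind

theorem sub2_mem {a b : ℕ} {l : List ℕ} (h : [a, b].Sublist l) : a ∈ l ∧ b ∈ l :=
  ⟨h.subset (by simp), h.subset (by simp)⟩

theorem sub3_mem {a b c : ℕ} {l : List ℕ} (h : [a, b, c].Sublist l) : a ∈ l ∧ b ∈ l ∧ c ∈ l :=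
  ⟨h.subset (by simp), h.subset (by simp), h.subset (by simp)⟩

theorem LA132.sub {l w : List ℕ} (h : l.Sublist w) (hw : LA132 w) : LA132 l :=
  fun a b c hs => hw a b c (hs.trans h)

theorem LA123.left {l r : List ℕ} (hw : LA123 (l ++ r)) : LA123 l := by
  intro u b c v e a ha
  exact hw u b c (v ++ r) (by simp [e]) a ha

theorem LA123.right {l r : List ℕ} (hw : LA123 (l ++ r)) : LA123 r := by
  intro u b c v e a ha
  exact hw (l ++ u) b c v (by simp [e]) a (by simp [ha])

theorem HasZig.sub {b k : ℕ} {l w : List ℕ} (h : l.Sublist w) : HasZig b k l → HasZig b k w :=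
  fun ⟨s, hs, h'⟩ => ⟨s, hs, h'.trans h⟩

theorem LA132_cons {M : ℕ} {R : List ℕ} (hM : ∀ x ∈ R, x < M) (hR : LA132 R) :
    LA132 (M :: R) := by
  intro a b c h h1 h2
  rw [← List.singleton_append (x := M)] at h
  rcases sub3_append _ _ _ _ _ h with h | h | h | h
  · have := sub3_mem h; simp at this; omega
  · have := sub2_mem h.1; simp at this; omega
  · have := sub2_mem h.2; have := hM _ this.1; have := h.1; simp at this; omega
  · exact hR _ _ _ h h1 h2

theorem LA123_cons {M : ℕ} {R : List ℕ} (hM : ∀ x ∈ R, x < M) (hR : LA123 R) :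
    LA123 (M :: R) := by
  intro u b c v e a ha h1 h2
  rcases u with _ | ⟨x, u⟩
  · simp at ha
  · simp at e
    rcases List.mem_cons.1 ha with rfl | ha
    · have := hM b (by simp [e.2]); omega
    · exact hR _ _ _ _ e.2 a ha h1 h2

theorem LA132_bin {L R : List ℕ} {t M : ℕ} (hL : LA132 L) (hR : LA132 R)
    (hLt : ∀ x ∈ L, t < x) (htR : ∀ x ∈ R, x < t) (hLM : ∀ x ∈ L, x < M) (htM : t < M) :
    LA132 (L ++ t :: M :: R) := by
  intro a b c h h1 h2
  rw [show L ++ t :: M :: R = L ++ ([t, M] ++ R) by simp] at h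
  rcases sub3_append _ _ _ _ _ h with h | ⟨h, h'⟩ | ⟨h, h'⟩ | h
  · exact hL _ _ _ h h1 h2
  · have h3 := hLt _ (sub2_mem h).1
    have h4 := hLM _ (sub2_mem h).1
    have h5 := hLM _ (sub2_mem h).2
    simp at h'
    rcases h' with rfl | rfl | h'
    · omega
    · omega
    · have := htR _ h'; omega
  · have h3 := hLt _ h
    rcases sub2_append _ _ _ _ h' with h | h | h
    · have := sub2_mem h; simp at this
      have : c = M := by omega
      have : b = M := by omega
      omega
    · have := htR _ h.2; omega
    · have := htR _ (sub2_mem h).2; omega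
  · rcases sub3_append _ _ _ _ _ h with h | ⟨h, h'⟩ | ⟨h, h'⟩ | h
    · have := h.length_le; simp at this
    · have h3 := sub2_mem h
      have := htR _ h'
      have h4 := h.eq_of_length rfl
      simp at h4; omega
    · have h3 := htR _ (sub2_mem h').1
      have h4 := htR _ (sub2_mem h').2
      rcases (show a = t ∨ a = M by simpa using h) with h | h
      · omega
      · omega
    · exact hR _ _ _ h h1 h2

theorem LA123_bin {L R : List ℕ} {t M : ℕ} (hL : LA123 L) (hR : LA123 R)
    (hLt : ∀ x ∈ L, t < x) (htR : ∀ x ∈ R, x < t) (htM : t < M) :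
    LA123 (L ++ t :: M :: R) := by
  intro u b c v e a ha h1 h2
  rw [List.append_eq_append_iff] at e
  rcases e with ⟨x, e1, e2⟩ | ⟨x, e1, e2⟩
  · rcases x with _ | ⟨y, _ | ⟨z, x⟩⟩
    · simp at e1 e2
      subst e1
      have := hLt a ha
      omega
    · simp at e1 e2
      have : c ∈ R := by simp [e2.2.2]
      have := htR _ this
      omega
    · simp at e1 e2
      have hb : b ∈ R := by simp [e2.2.2]
      have := htR _ hb
      subst e1
      simp at ha
      rcases ha with ha | ha | ha | ha
      · have := hLt a ha; omega
      · omega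
      · omega
      · exact hR _ _ _ _ e2.2.2 a ha h1 h2
  · rcases x with _ | ⟨y, _ | ⟨z, x⟩⟩
    · simp at e1 e2
      subst e1
      have := hLt a ha
      omega
    · simp at e1 e2
      have hb : b ∈ L := by simp [e1, e2]
      have := hLt b hb
      omega
    · simp at e1 e2
      exact hL u b c x (by simp [e1, e2]) a ha h1 h2

theorem HasZig_nil (b k : ℕ) : ¬ HasZig b (k + 1) [] := by
  rintro ⟨s, ⟨s', a, m, rfl, -⟩, h⟩
  simp at h

theorem HasZig_cons {b k M : ℕ} {R : List ℕ} (hM : ∀ x ∈ R, x < M)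
    (h : HasZig b (k + 1) (M :: R)) : HasZig b (k + 1) R := by
  obtain ⟨s, hs, h⟩ := h
  refine ⟨s, hs, ?_⟩
  obtain ⟨s', a, m, rfl, hs', hx, ham⟩ := hs
  rcases s' with _ | ⟨y, s'⟩
  · simp only [List.nil_append] at h ⊢
    rcases List.cons_sublist_cons'.1 h with h | ⟨rfl, h'⟩
    · exact h
    · have := hM m (h'.subset (by simp)); omega
  · simp only [List.cons_append] at h ⊢
    rcases List.cons_sublist_cons'.1 h with h | ⟨rfl, h'⟩
    · exact h
    · have := hM m (h'.subset (by simp)); have := hx y (by simp); omega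

theorem HasZig_bin {b k : ℕ} {L R : List ℕ} {t M : ℕ}
    (hLt : ∀ x ∈ L, t < x) (htR : ∀ x ∈ R, x < t) (hLM : ∀ x ∈ L, x < M) (htM : t < M) :
    HasZig b (k + 1) (L ++ t :: M :: R) ↔ HasZig b k L ∨ HasZig b (k + 1) R := by
  constructor
  · rintro ⟨s, hs, h⟩
    have hs0 := hs
    obtain ⟨s', a, m, rfl, hs', hx, ham⟩ := hs
    rw [show L ++ t :: M :: R = (L ++ [t, M]) ++ R by simp, List.sublist_append_iff] at h
    obtain ⟨l1, l2, e, h1, h2⟩ := h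
    rcases l2.eq_nil_or_concat' with rfl | ⟨l2', z, rfl⟩
    · left
      refine ⟨s', hs', ?_⟩
      simp only [List.append_nil] at e
      subst e
      rw [List.sublist_append_iff] at h1
      obtain ⟨u, v, e, h3, h4⟩ := h1
      have hv := h4.length_le
      rw [List.append_eq_append_iff] at e
      rcases e with ⟨x, e1, e2⟩ | ⟨x, e1, e2⟩
      · subst e1
        exact (List.sublist_append_left _ _).trans h3
      · have : x = [] := by
          have := congrArg List.length e2
          simp at this hv
          exact List.length_eq_zero_iff.1 (by omega)
        subst this
        simp at e1
        subst e1; exact h3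
    · right
      have e' : (s' ++ [a]) ++ [m] = (l1 ++ l2') ++ [z] := by simpa using e
      obtain ⟨e3, e4⟩ := List.append_inj' e' rfl
      simp at e4
      subst e4
      have hm := htR m (h2.subset (by simp))
      have : l1 = [] := by
        rcases l1 with _ | ⟨y, l1⟩
        · rfl
        · have hy : y ∈ s' ++ [a] := by rw [e3]; simp
          have : y < m := by
            rcases List.mem_append.1 hy with hy | hy
            · exact (hx y hy).2
            · simp at hy; omega
          have := h1.subset (show y ∈ y :: l1 by simp)
          simp at this
          rcases this with h | h | h
          · have := hLt y h; omega
          · omega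
          · omega
      subst this
      refine ⟨_, hs0, ?_⟩
      rw [e]; exact h2
  · rintro (⟨s, hs, h⟩ | h)
    · refine ⟨s ++ [t, M], ⟨s, t, M, rfl, hs, fun x hx => ⟨hLt x (h.subset hx), hLM x (h.subset hx)⟩, htM⟩, ?_⟩
      exact h.append (by simp)
    · exact h.sub (by
        rw [show L ++ t :: M :: R = (L ++ [t, M]) ++ R by simp]
        exact List.sublist_append_right _ _)

theorem LA132_nil : LA132 [] := by intro a b c h; simp at h
theorem LA123_nil : LA123 [] := by intro u b c v h; simp at h

theorem Good_zero {b k o : ℕ} (w : List ℕ) : Good b (k + 1) 0 o w ↔ w = [] := by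
  constructor
  · rintro ⟨⟨-, h⟩, -⟩
    rw [List.eq_nil_iff_forall_not_mem]
    intro x hx
    have := (h x).1 hx
    omega
  · rintro rfl
    exact ⟨⟨by simp, by intro x; simp⟩, LA132_nil, LA123_nil, HasZig_nil b k⟩

theorem downclosed {n o : ℕ} (R : List ℕ) (hR : ∀ x ∈ R, o ≤ x ∧ x < o + n)
    (hd : ∀ x ∈ R, ∀ y, o ≤ y → y < x → y ∈ R) :
    ∃ j, j ≤ n ∧ ∀ x, x ∈ R ↔ o ≤ x ∧ x < o + j := by
  classical
  have hex : ∃ j, o + j ∉ R := ⟨n, fun h => by have := hR _ h; omega⟩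
  refine ⟨Nat.find hex, Nat.find_min' hex (fun h => by have := hR _ h; omega), ?_⟩
  intro x
  constructor
  · intro hx
    refine ⟨(hR x hx).1, ?_⟩
    by_contra hlt
    push Not at hlt
    apply Nat.find_spec hex
    rcases Nat.eq_or_lt_of_le hlt with h | h
    · rw [h]; exact hx
    · exact hd x hx _ (by omega) h
  · rintro ⟨h1, h2⟩
    have := Nat.find_min hex (m := x - o) (by omega)
    push Not at this
    rwa [Nat.add_sub_cancel' h1] at this

theorem Good_succ {b k n o : ℕ} (w : List ℕ) : Good b (k + 1) (n + 1) o w ↔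
    (∃ R, Good b (k + 1) n o R ∧ w = (o + n) :: R) ∨
    (∃ j < n, ∃ L R, Good b k (n - 1 - j) (o + j + 1) L ∧ Good b (k + 1) j o R ∧
      w = L ++ (o + j) :: (o + n) :: R) := by
  constructor
  · rintro ⟨⟨hnd, hw⟩, h132, h123, hz⟩
    have hM : o + n ∈ w := (hw _).2 (by omega)
    obtain ⟨L0, R, rfl⟩ := List.append_of_mem hM
    have hLR : ∀ x ∈ L0, ∀ y ∈ R, y < x := by
      intro x hx y hy
      have h1 := (hw y).1 (by simp [hy])
      have hyM : y ≠ o + n := by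
        rintro rfl
        simp [List.nodup_append, hy] at hnd
      have hxy : x ≠ y := by
        rintro rfl
        simp [List.nodup_append] at hnd
        exact (hnd.2.2 x hx).2 x hy rfl
      by_contra hlt
      refine h132 x (o + n) y ?_ (by omega) (by omega)
      exact (List.singleton_sublist.2 hx).append ((List.singleton_sublist.2 hy).cons_cons _)
    rcases L0.eq_nil_or_concat' with rfl | ⟨L, t, rfl⟩
    · left
      simp only [List.nil_append] at *
      refine ⟨R, ⟨⟨(List.nodup_cons.1 hnd).2, ?_⟩, h132.sub (by simp), ?_, ?_⟩, rfl⟩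
      · intro x
        have := hw x
        have h2 := (List.nodup_cons.1 hnd).1
        constructor
        · intro hx
          have h3 := this.1 (by simp [hx])
          have : x ≠ o + n := by rintro rfl; exact h2 hx
          omega
        · intro hx
          have h3 := this.2 (by omega)
          rcases List.mem_cons.1 h3 with h3 | h3
          · omega
          · exact h3
      · exact LA123.right (l := [o + n]) (by simpa using h123)
      · exact fun h => hz (h.sub (by simp))
    · right
      have hw' : ∀ x, (x ∈ L ∨ x = t ∨ x = o + n ∨ x ∈ R) ↔ o ≤ x ∧ x < o + (n + 1) := by
        intro x; rw [← hw x]; simp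
      have hnd' : L.Nodup ∧ R.Nodup ∧ t ∉ L ∧ o + n ∉ L ∧ (∀ x ∈ L, x ∉ R) ∧ t ≠ o + n ∧ t ∉ R ∧
          o + n ∉ R := by
        simp [List.nodup_append] at hnd
        grind
      obtain ⟨n1, n2, n3, n4, n5, n6, n7, n8⟩ := hnd'
      have htM : t < o + n := by have := (hw' t).1 (by simp); omega
      have hLt : ∀ x ∈ L, t < x := by
        intro x hx
        have : x ≠ t := by rintro rfl; exact n3 hx
        by_contra hlt
        exact h123 L t (o + n) R (by simp) x hx (by omega) htM
      have htR : ∀ x ∈ R, x < t := fun x hx => hLR t (by simp) x hx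
      have hLM : ∀ x ∈ L, x < o + n := by
        intro x hx
        have h1 := (hw' x).1 (by simp [hx])
        have : x ≠ o + n := by rintro rfl; exact n4 hx
        omega
      obtain ⟨j, hjn, hj⟩ := downclosed (n := n) (o := o) R (by
          intro x hx
          have h1 := (hw' x).1 (by simp [hx])
          have := htR x hx
          omega) (by
          intro x hx y hy hyx
          have := htR x hx
          rcases (hw' y).2 (by omega) with h | h | h | h
          · have := hLt y h; omega
          · omega
          · omega
          · exact h)
      have htj : t = o + j := by
        have h1 : ¬ (o ≤ t ∧ t < o + j) := fun h => n7 ((hj t).2 h)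
        have h2 := (hw' t).1 (by simp)
        rcases (hw' (o + j)).2 (by omega) with h | h | h | h
        · have := hLt _ h; omega
        · omega
        · omega
        · have := (hj _).1 h; omega
      subst htj
      have hz' := (HasZig_bin (b := b) (k := k) hLt htR hLM htM).not.1 (by simpa using hz)
      push Not at hz'
      refine ⟨j, by omega, L, R, ⟨⟨n1, ?_⟩, h132.sub (by simp), ?_, hz'.1⟩,
        ⟨⟨n2, hj⟩, h132.sub ?_, ?_, hz'.2⟩, by simp⟩
      · intro x
        constructor
        · intro hx
          have := hLt x hx
          have := hLM x hx
          omega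
        · intro hx
          rcases (hw' x).2 (by omega) with h | h | h | h
          · exact h
          · omega
          · omega
          · have := (hj _).1 h; omega
      · exact LA123.left (LA123.left h123)
      · exact (List.sublist_cons_self _ _).trans (List.sublist_append_right _ _)
      · exact LA123.right (l := (L ++ [o + j]) ++ [o + n]) (by simpa using h123)
  · rintro (⟨R, ⟨⟨h1, h2⟩, h3, h4, h5⟩, rfl⟩ | ⟨j, hjn, L, R, ⟨⟨h1, h2⟩, h3, h4, h5⟩,
      ⟨⟨g1, g2⟩, g3, g4, g5⟩, rfl⟩)
    · have hM : ∀ x ∈ R, x < o + n := fun x hx => ((h2 x).1 hx).2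
      refine ⟨⟨List.nodup_cons.2 ⟨fun h => by have := hM _ h; omega, h1⟩, ?_⟩, LA132_cons hM h3,
        LA123_cons hM h4, fun h => h5 (HasZig_cons hM h)⟩
      intro x
      simp [h2]; omega
    · have hLt : ∀ x ∈ L, o + j < x := fun x hx => by have := (h2 x).1 hx; omega
      have hLM : ∀ x ∈ L, x < o + n := fun x hx => by have := (h2 x).1 hx; omega
      have htR : ∀ x ∈ R, x < o + j := fun x hx => by have := (g2 x).1 hx; omega
      have htM : o + j < o + n := by omega
      refine ⟨⟨?_, ?_⟩, LA132_bin h3 g3 hLt htR hLM htM, LA123_bin h4 g4 hLt htR htM, ?_⟩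
      · rw [List.nodup_append]
        refine ⟨h1, ?_, ?_⟩
        · simp [g1, g2]; omega
        · intro x hx y hy
          have := hLt x hx
          have := hLM x hx
          simp at hy
          rcases hy with hy | hy | hy
          · omega
          · omega
          · have := htR y hy; omega
      · intro x
        simp [h2, g2]; omega
      · rw [HasZig_bin hLt htR hLM htM]; tauto

def cc (a : ℕ → ℕ) : ℕ → ℕ
  | 0 => 1
  | n + 1 => cc a n + ∑ j : Fin n, a (n - 1 - j) * cc a j
termination_by n => n
decreasing_by all_goals omega

def IsCount (b k : ℕ) (c : ℕ → ℕ) : Prop :=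
  ∀ n o, ∃ F : Finset (List ℕ), (∀ w, w ∈ F ↔ Good b k n o w) ∧ F.card = c n

theorem append2_inj {M t t' : ℕ} {L R L' R' : List ℕ} (h1 : M ∉ L) (h2 : M ∉ L') (h3 : M ≠ t)
    (h4 : M ≠ t') (e : L ++ t :: M :: R = L' ++ t' :: M :: R') : L = L' ∧ t = t' ∧ R = R' := by
  have e' : (L ++ [t]) ++ M :: R = (L' ++ [t']) ++ M :: R' := by simpa using e
  have k1 : M ∉ L ++ [t] := by simp [h1, h3]
  have k2 : M ∉ L' ++ [t'] := by simp [h2, h4]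
  have e1 : L ++ [t] = L' ++ [t'] := by
    rw [List.append_eq_append_iff] at e'
    rcases e' with ⟨x, e1, e2⟩ | ⟨x, e1, e2⟩
    · rcases x with _ | ⟨y, x⟩
      · simpa using e1.symm
      · exfalso
        simp only [List.cons_append, List.cons.injEq] at e2
        apply k2; rw [e1, e2.1]; simp
    · rcases x with _ | ⟨y, x⟩
      · simpa using e1
      · exfalso
        simp only [List.cons_append, List.cons.injEq] at e2
        apply k1; rw [e1, e2.1]; simp
  have e2 : R = R' := by rw [e1] at e'; simpa using e'
  have := List.append_inj' e1 rfl
  simp at this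
  exact ⟨this.1, this.2, e2⟩

theorem IsCount_step {b k : ℕ} {a : ℕ → ℕ} (ha : IsCount b k a) : IsCount b (k + 1) (cc a) := by
  classical
  intro n
  induction n using Nat.strong_induction_on with
  | _ n ih =>
  intro o
  rcases n with _ | n
  · exact ⟨{[]}, fun w => by simp [Good_zero], by simp [cc]⟩
  · obtain ⟨F, hF, cF⟩ := ih n (by omega) o
    choose G hG cG using fun j : Fin n => ih j (by omega) o
    choose H hH cH using fun j : Fin n => ha (n - 1 - j) (o + j + 1)
    have hML : ∀ (j : Fin n) (L), L ∈ H j → o + n ∉ L := by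
      intro j L hL h
      have := (((hH j L).1 hL).1.2 _).1 h
      omega
    refine ⟨F.image (fun R => (o + n) :: R) ∪ Finset.univ.biUnion fun j : Fin n =>
      (H j ×ˢ G j).image (fun p => p.1 ++ (o + j) :: (o + n) :: p.2), ?_, ?_⟩
    · intro w
      rw [Good_succ]
      simp only [Finset.mem_union, Finset.mem_image, Finset.mem_biUnion, Finset.mem_univ, true_and,
        Finset.mem_product, hF, hG, hH, Prod.exists]
      constructor
      · rintro (⟨R, h, rfl⟩ | ⟨j, L, R, ⟨h, h'⟩, rfl⟩)
        · exact Or.inl ⟨R, h, rfl⟩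
        · exact Or.inr ⟨j, j.2, L, R, h, h', rfl⟩
      · rintro (⟨R, h, rfl⟩ | ⟨j, hj, L, R, h, h', rfl⟩)
        · exact Or.inl ⟨R, h, rfl⟩
        · exact Or.inr ⟨⟨j, hj⟩, L, R, ⟨h, h'⟩, rfl⟩
    · rw [Finset.card_union_of_disjoint, Finset.card_image_of_injective, cF, Finset.card_biUnion, cc]
      · congr 1
        refine Finset.sum_congr rfl fun j _ => ?_
        rw [Finset.card_image_of_injOn, Finset.card_product, cH, cG]
        rintro ⟨L, R⟩ h ⟨L', R'⟩ h' e
        simp only [Finset.coe_product, Set.mem_prod, Finset.mem_coe] at h h' e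
        have := append2_inj (hML j _ h.1) (hML j _ h'.1) (by omega) (by omega) e
        simp [this.1, this.2.2]
      · intro i _ j _ hij
        rw [Function.onFun, Finset.disjoint_left]
        intro w h h'
        simp only [Finset.mem_image, Finset.mem_product, Prod.exists] at h h'
        obtain ⟨L, R, h, rfl⟩ := h
        obtain ⟨L', R', h', e⟩ := h'
        have := append2_inj (hML j _ h'.1) (hML i _ h.1) (by omega) (by omega) e
        exact hij (Fin.ext (by omega))
      · intro x y h; simpa using h
      · rw [Finset.disjoint_left]
        intro w h h'
        simp only [Finset.mem_image, Finset.mem_biUnion, Finset.mem_univ, true_and,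
          Finset.mem_product, Prod.exists] at h h'
        obtain ⟨R0, h, rfl⟩ := h
        obtain ⟨j, L, R, ⟨h, h'⟩, e⟩ := h'
        have hL := hML j L h
        rcases L with _ | ⟨y, L⟩
        · simp at e; omega
        · simp at e hL; omega

theorem cc_gf (a : ℕ → ℕ) (A C : PowerSeries ℚ) (hA : A = PowerSeries.mk fun n => (a n : ℚ))
    (hC : C = PowerSeries.mk fun n => (cc a n : ℚ)) :
    C = 1 + PowerSeries.X * C + PowerSeries.X ^ 2 * (A * C) := by
  ext n
  rcases n with _ | _ | n
  · simp [hC, cc]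
  · simp [hC, cc, pow_two, mul_assoc, PowerSeries.coeff_one]
  · rw [map_add, map_add, PowerSeries.coeff_succ_X_mul, pow_two, mul_assoc,
      PowerSeries.coeff_succ_X_mul, PowerSeries.coeff_succ_X_mul, PowerSeries.coeff_mul]
    subst hA hC
    simp only [PowerSeries.coeff_mk, PowerSeries.coeff_one]
    rw [cc]
    rw [← Finset.Nat.sum_antidiagonal_swap,
      Finset.Nat.sum_antidiagonal_eq_sum_range_succ_mk, ← Fin.sum_univ_eq_sum_range
      (fun k => (a (Prod.swap (k, n - k)).1 : ℚ) * cc a (Prod.swap (k, n - k)).2)]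
    push_cast
    simp

noncomputable def cnt (b : ℕ) : ℕ → ℕ → ℕ
  | 0, n => if n < b then 1 else 0
  | k + 1, n => cc (cnt b k) n

theorem IsCount_cnt (b : ℕ) (hb : b ≤ 1) (k : ℕ) : IsCount b k (cnt b k) := by
  induction k with
  | succ k ih => exact IsCount_step ih
  | zero =>
    intro n o
    have key : ∀ w, ¬ HasZig b 0 w ↔ w.length < b := by
      intro w
      rw [← not_le]
      apply not_congr
      constructor
      · rintro ⟨s, hs, h⟩
        simp only [Zig] at hs
        have := h.length_le
        omega
      · intro h
        exact ⟨w.take b, by simp [Zig, h], List.take_sublist _ _⟩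
    by_cases hn : n < b
    · refine ⟨{[]}, ?_, by simp [cnt, hn]⟩
      intro w
      simp only [Finset.mem_singleton, Good, key]
      constructor
      · rintro rfl
        refine ⟨⟨by simp, fun x => by simp; omega⟩, LA132_nil, LA123_nil, by simp; omega⟩
      · rintro ⟨-, -, -, h⟩
        exact List.length_eq_zero_iff.1 (by omega)
    · refine ⟨∅, ?_, by simp [cnt, hn]⟩
      intro w
      simp only [Finset.notMem_empty, Good, key, false_iff]
      rintro ⟨⟨-, h⟩, -, -, h'⟩
      have : w = [] := List.length_eq_zero_iff.1 (by omega)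
      subst this
      have := h o
      simp at this h'
      omega

noncomputable def cgf (b k : ℕ) : PowerSeries ℚ := PowerSeries.mk fun n => (cnt b k n : ℚ)

theorem cgf_step (b k : ℕ) :
    cgf b (k + 1) * (1 - PowerSeries.X - PowerSeries.X ^ 2 * cgf b k) = 1 := by
  have := cc_gf (cnt b k) (cgf b k) (cgf b (k + 1)) rfl rfl
  linear_combination this

theorem cgf_zero (k : ℕ) : cgf 0 k * qcheb (k + 1) = qcheb k := by
  induction k with
  | zero => ext n; simp [cgf, cnt, qcheb]
  | succ k ih =>
    have := cgf_step 0 k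
    rw [qcheb]
    linear_combination qcheb (k + 1) * this + PowerSeries.X ^ 2 * cgf 0 (k + 1) * ih

theorem cgf_one (k : ℕ) : cgf 1 k * (qcheb (k + 2) + PowerSeries.X * qcheb (k + 1)) =
    qcheb (k + 1) + PowerSeries.X * qcheb k := by
  induction k with
  | zero =>
    have : cgf 1 0 = 1 := by ext n; simp [cgf, cnt, PowerSeries.coeff_one]
    rw [this]; simp [qcheb]
  | succ k ih =>
    have := cgf_step 1 k
    have e1 : qcheb (k + 1 + 2) = (1 - PowerSeries.X) * qcheb (k + 2) - PowerSeries.X ^ 2 * qcheb (k + 1) := by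
      rw [qcheb]
    have e2 : qcheb (k + 2) = (1 - PowerSeries.X) * qcheb (k + 1) - PowerSeries.X ^ 2 * qcheb k := by
      rw [qcheb]
    rw [e1]
    linear_combination (qcheb (k + 2) + PowerSeries.X * qcheb (k + 1)) * this + PowerSeries.X ^ 2 * cgf 1 (k + 1) * ih + cgf 1 (k + 1) * PowerSeries.X * e2

theorem sublist_ofFn {n : ℕ} (s : List ℕ) (g : Fin n → ℕ) :
    s.Sublist (List.ofFn g) ↔ ∃ f : Fin s.length → Fin n, StrictMono f ∧ ∀ i, s[i] = g (f i) := by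
  rw [List.sublist_iff_exists_fin_orderEmbedding_get_eq]
  constructor
  · rintro ⟨f, hf⟩
    refine ⟨fun i => Fin.cast (by simp) (f i), fun i j h => ?_, fun i => ?_⟩
    · have := f.strictMono h
      exact this
    · have := hf i
      simp only [List.get_ofFn] at this
      exact this
  · rintro ⟨f, hf, h⟩
    refine ⟨OrderEmbedding.ofStrictMono (fun i => Fin.cast (by simp) (f i)) fun i j h => ?_,
      fun i => ?_⟩
    · have := hf h
      exact this
    · have := h i
      simp only [List.get_ofFn]
      exact this

theorem LA132_ofFn {n : ℕ} (π : Equiv.Perm (Fin n)) :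
    LA132 (List.ofFn fun i => (π i : ℕ)) ↔ Avoids132 π := by
  constructor
  · rintro h ⟨i, j, k, hij, hjk, h1, h2⟩
    refine h (π i) (π j) (π k) ?_ h1 h2
    rw [sublist_ofFn]
    refine ⟨![i, j, k], ?_, ?_⟩
    · have hm : StrictMono (![i, j, k] : Fin 3 → Fin n) := by
        intro x y hxy
        have := hij.trans hjk
        fin_cases x <;> fin_cases y <;> first | exact hij | exact hjk | exact this | exact absurd hxy (by decide)
      exact hm
    · intro x
      fin_cases x <;> rfl
  · intro h a b c hs h1 h2
    rw [sublist_ofFn] at hs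
    obtain ⟨f, hf, e⟩ := hs
    have e0 := e (0 : Fin 3)
    have e1 := e (1 : Fin 3)
    have e2 := e (2 : Fin 3)
    simp at e0 e1 e2
    refine h ⟨f (0 : Fin 3), f (1 : Fin 3), f (2 : Fin 3), hf ?_, hf ?_, ?_, ?_⟩
    · exact (by decide : (0 : Fin 3) < 1)
    · exact (by decide : (1 : Fin 3) < 2)
    · rw [Fin.lt_def]; omega
    · rw [Fin.lt_def]; omega

theorem LA123_ofFn {n : ℕ} (π : Equiv.Perm (Fin n)) :
    LA123 (List.ofFn fun i => (π i : ℕ)) ↔ Avoids1_23 π := by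
  constructor
  · rintro h ⟨i, j, hj, hij, h1, h2⟩
    set w := List.ofFn fun i => (π i : ℕ) with hw
    have hl : w.length = n := by simp [hw]
    refine h (w.take j) (π j) (π ⟨j + 1, hj⟩) (w.drop (j + 2)) ?_ (π i) ?_ h1 h2
    · conv_lhs => rw [← List.take_append_drop j w]
      rw [List.drop_eq_getElem_cons (by omega), List.drop_eq_getElem_cons (by omega)]
      simp [hw]
    · rw [List.mem_take_iff_getElem]
      refine ⟨i, by simp [hl]; exact hij, by simp [hw]⟩
  · intro h u b c v e a ha h1 h2
    have hl : n = u.length + (v.length + 1 + 1) := by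
      have := congrArg List.length e; simpa using this
    obtain ⟨i, hi, rfl⟩ := List.getElem_of_mem ha
    have key : ∀ (m : ℕ) (hm : m < n), (π ⟨m, hm⟩ : ℕ) =
        (u ++ b :: c :: v)[m]'(by simp; omega) := by
      intro m hm
      simp [← e]
    have k1 := key i (by omega)
    have k2 := key u.length (by omega)
    have k3 := key (u.length + 1) (by omega)
    rw [List.getElem_append_left hi] at k1
    simp at k2
    simp [List.getElem_append_right] at k3
    refine h ⟨⟨i, by omega⟩, ⟨u.length, by omega⟩, by simp; omega, ?_, ?_, ?_⟩
    · exact hi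
    · rw [Fin.lt_def]; omega
    · rw [Fin.lt_def]; simp only; omega

theorem Zig_iff {b : ℕ} (hb : b ≤ 1) (k : ℕ) (s : List ℕ) :
    Zig b k s ↔ ∃ hl : s.length = 2 * k + b, ∀ (i j : ℕ) (hij : i < j) (hj : j < 2 * k + b),
      if (j + b) % 2 = 1 then s[i] < s[j] else s[j] < s[i] := by
  induction k generalizing s with
  | zero =>
    simp only [Zig]
    constructor
    · intro h
      exact ⟨by omega, fun i j hij hj => by omega⟩
    · rintro ⟨h, -⟩; omega
  | succ k ih =>
    simp only [Zig]
    constructor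
    · rintro ⟨s', a, m, rfl, hs', hx, ham⟩
      obtain ⟨hl, h⟩ := (ih s').1 hs'
      refine ⟨by simp [hl]; omega, fun i j hij hj => ?_⟩
      rcases lt_or_ge j (2 * k + b) with hj' | hj'
      · rw [List.getElem_append_left (by omega), List.getElem_append_left (by omega)]
        exact h i j hij hj'
      · rcases Nat.eq_or_lt_of_le hj' with rfl | hj''
        · rw [if_neg (by omega), List.getElem_append_left (show i < s'.length by omega)]
          simp only [← hl]
          simp
          exact (hx _ (List.getElem_mem _)).1
        · obtain rfl : j = 2 * k + b + 1 := by omega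
          rw [if_pos (by omega)]
          have ej : (s' ++ [a, m])[2 * k + b + 1]'(by simp; omega) = m := by
            simp only [← hl]
            simp [List.getElem_append_right]
          rw [ej]
          rcases Nat.eq_or_lt_of_le (Nat.le_of_lt_succ hij) with rfl | hi
          · simp only [← hl]
            simpa [List.getElem_append_right] using ham
          · rw [List.getElem_append_left (show i < s'.length by omega)]
            exact (hx _ (List.getElem_mem _)).2
    · rintro ⟨hl, h⟩
      have hs : s = s.take (2 * k + b) ++ [s[2 * k + b], s[2 * k + b + 1]] := by
        conv_lhs => rw [← List.take_append_drop (2 * k + b) s]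
        rw [List.drop_eq_getElem_cons (by omega), List.drop_eq_getElem_cons (by omega)]
        rw [List.drop_eq_nil_of_le (by omega)]
      refine ⟨_, _, _, hs, ?_, ?_, ?_⟩
      · rw [ih]
        refine ⟨by simp; omega, fun i j hij hj => ?_⟩
        have := h i j hij (by omega)
        simpa using this
      · intro x hx
        rw [List.mem_take_iff_getElem] at hx
        obtain ⟨i, hi, rfl⟩ := hx
        have h1 := h i (2 * k + b) (by omega) (by omega)
        have h2 := h i (2 * k + b + 1) (by omega) (by omega)
        rw [if_neg (by omega)] at h1
        rw [if_pos (by omega)] at h2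
        exact ⟨h1, h2⟩
      · have h2 := h (2 * k + b) (2 * k + b + 1) (by omega) (by omega)
        rw [if_pos (by omega)] at h2
        exact h2

theorem HasZig_ofFn {b k n : ℕ} (hb : b ≤ 1) (p : Equiv.Perm (Fin (2 * k + b)))
    (hp : ∀ i j, i < j → (p i < p j ↔ ((j : ℕ) + b) % 2 = 1)) (π : Equiv.Perm (Fin n)) :
    HasZig b k (List.ofFn fun i => (π i : ℕ)) ↔ ContainsPatt p π := by
  constructor
  · rintro ⟨s, hs, h⟩
    obtain ⟨hl, hz⟩ := (Zig_iff hb k s).1 hs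
    obtain ⟨f, hf, e⟩ := (sublist_ofFn _ _).1 h
    have key : ∀ i j : Fin (2 * k + b), i < j →
        (p i < p j ↔ π (f (Fin.cast hl.symm i)) < π (f (Fin.cast hl.symm j))) := by
      intro i j hij
      rw [hp i j hij]
      have h1 := hz i j hij j.2
      have ei := e (Fin.cast hl.symm i)
      have ej := e (Fin.cast hl.symm j)
      simp at ei ej
      rw [Fin.lt_def, ← ei, ← ej]
      split_ifs at h1 with h2
      · simp [h1, h2]
      · simp only [h2, false_iff]; omega
    refine ⟨fun i => f (Fin.cast hl.symm i), fun i j hij => hf (by simpa using hij), ?_⟩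
    intro i j
    rcases lt_trichotomy i j with h | rfl | h
    · exact key i j h
    · simp
    · have h1 := (key j i h).not
      have n1 : p i ≠ p j := fun h' => h.ne' (p.injective h')
      have n2 : π (f (Fin.cast hl.symm i)) ≠ π (f (Fin.cast hl.symm j)) := fun h' => h.ne' (by
        simpa using hf.injective (π.injective h'))
      rw [not_lt, not_lt] at h1
      rw [lt_iff_le_and_ne, h1, lt_iff_le_and_ne]
      simp only [n1, n2, ne_eq, not_false_eq_true]
  · rintro ⟨f, hf, h⟩
    refine ⟨List.ofFn fun i => (π (f i) : ℕ), ?_, ?_⟩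
    · rw [Zig_iff hb]
      refine ⟨by simp, fun i j hij hj => ?_⟩
      simp only [List.getElem_ofFn]
      have h1 := hp ⟨i, by omega⟩ ⟨j, hj⟩ hij
      rw [h] at h1
      split_ifs with h2
      · exact h1.2 h2
      · have h3 : ¬ _ := fun h' => h2 (h1.1 h')
        have n2 : π (f ⟨i, by omega⟩) ≠ π (f ⟨j, hj⟩) := fun h' => hij.ne (by
          simpa using hf.injective (π.injective h'))
        rw [not_lt] at h3
        exact Fin.lt_def.1 (lt_of_le_of_ne h3 n2.symm)
    · rw [sublist_ofFn]
      refine ⟨fun i => f (Fin.cast (by simp) i), fun i j hij => hf (by simpa using hij), ?_⟩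
      intro i
      simp only [Fin.getElem_fin, List.getElem_ofFn]
      rfl

theorem Good_ofFn {b k n : ℕ} (hb : b ≤ 1) (p : Equiv.Perm (Fin (2 * k + b)))
    (hp : ∀ i j, i < j → (p i < p j ↔ ((j : ℕ) + b) % 2 = 1)) (π : Equiv.Perm (Fin n)) :
    Good b k n 0 (List.ofFn fun i => (π i : ℕ)) ↔ IsMotzkinPerm π ∧ ¬ ContainsPatt p π := by
  rw [Good, LA132_ofFn, LA123_ofFn, HasZig_ofFn hb p hp, IsMotzkinPerm]
  have : IsSeg n 0 (List.ofFn fun i => (π i : ℕ)) := by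
    refine ⟨?_, ?_⟩
    · rw [List.nodup_ofFn]
      exact Fin.val_injective.comp π.injective
    · intro x
      rw [List.mem_ofFn]
      constructor
      · rintro ⟨i, rfl⟩; simp
      · rintro ⟨-, hx⟩
        exact ⟨π.symm ⟨x, by omega⟩, by simp⟩
  tauto

theorem exists_perm {n : ℕ} {w : List ℕ} (h : IsSeg n 0 w) :
    ∃ π : Equiv.Perm (Fin n), (List.ofFn fun i => (π i : ℕ)) = w := by
  obtain ⟨h1, h2⟩ := h
  have hl : w.length = n := by
    rw [← List.toFinset_card_of_nodup h1]
    have : w.toFinset = Finset.range n := by ext x; simp [h2]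
    simp [this]
  have hlt : ∀ i : Fin n, w[i] < n := fun i => by
    have := (h2 (w[i])).1 (List.getElem_mem _); omega
  have hinj : Function.Injective (fun i : Fin n => (⟨w[i], hlt i⟩ : Fin n)) := by
    intro i j hij
    simp only [Fin.mk.injEq] at hij
    exact Fin.ext ((h1.getElem_inj_iff).1 hij)
  refine ⟨Equiv.ofBijective _ (Finite.injective_iff_bijective.1 hinj), ?_⟩
  apply List.ext_getElem
  · simp [hl]
  · intro i hi hi'
    simp

theorem Ngf_eq {b k : ℕ} (hb : b ≤ 1) (p : Equiv.Perm (Fin (2 * k + b)))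
    (hp : ∀ i j, i < j → (p i < p j ↔ ((j : ℕ) + b) % 2 = 1)) : Ngf p = cgf b k := by
  ext n
  simp only [Ngf, cgf, PowerSeries.coeff_mk]
  obtain ⟨F, hF, cF⟩ := IsCount_cnt b hb k n 0
  rw [← cF, ← Nat.card_eq_finsetCard]
  congr 1
  refine Nat.card_congr (Equiv.ofBijective (fun π => ⟨List.ofFn fun i => (π.1 i : ℕ),
    (hF _).2 ((Good_ofFn hb p hp _).2 π.2)⟩) ⟨?_, ?_⟩)
  · rintro ⟨π, h⟩ ⟨π', h'⟩ e
    simp only [Subtype.mk.injEq] at e ⊢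
    have := List.ofFn_injective e
    ext i
    exact congrFun this i
  · rintro ⟨w, hw⟩
    have hg := (hF _).1 hw
    obtain ⟨π, rfl⟩ := exists_perm hg.1
    exact ⟨⟨π, (Good_ofFn hb p hp _).1 hg⟩, rfl⟩

open PowerSeries in
/-- For `σ = k(k+1)(k-1)(k+2)…1(2k)` one has `N_σ q_k = q_{k-1}`, and for
`τ = (k+1)k(k+2)(k-1)…1(2k+1)` one has `N_τ (q_{k+1} + x q_k) = q_k + x q_{k-1}`.
(Values 0-indexed: `σ (2i) = k-1-i`, `σ (2i+1) = k+i`; `τ (2i) = k+i`, `τ (2i+1) = k-1-i`.) -/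
theorem Ngf_zigzag (k : ℕ) (hk : 1 ≤ k)
    (σ : Equiv.Perm (Fin (2 * k)))
    (hσ : ∀ i : Fin k,
      (σ ⟨2 * (i : ℕ), by have := i.isLt; omega⟩ : ℕ) = k - 1 - (i : ℕ) ∧
      (σ ⟨2 * (i : ℕ) + 1, by have := i.isLt; omega⟩ : ℕ) = k + (i : ℕ))
    (τ : Equiv.Perm (Fin (2 * k + 1)))
    (hτev : ∀ i : Fin (k + 1),
      (τ ⟨2 * (i : ℕ), by have := i.isLt; omega⟩ : ℕ) = k + (i : ℕ))
    (hτod : ∀ i : Fin k,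
      (τ ⟨2 * (i : ℕ) + 1, by have := i.isLt; omega⟩ : ℕ) = k - 1 - (i : ℕ)) :
    Ngf σ * qcheb (k + 1) = qcheb k ∧
    Ngf τ * (qcheb (k + 2) + X * qcheb (k + 1)) = qcheb (k + 1) + X * qcheb k := by

  constructor
  · have hs : ∀ (m : ℕ) (hm : m < 2 * k), (σ ⟨m, hm⟩ : ℕ) =
        if m % 2 = 1 then k + m / 2 else k - 1 - m / 2 := by
      intro m hm
      have h := hσ ⟨m / 2, by omega⟩
      split_ifs with h2
      · have e : (⟨m, hm⟩ : Fin (2 * k)) = ⟨2 * (m / 2) + 1, by omega⟩ := Fin.ext (by simp; omega)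
        rw [e]; exact h.2
      · have e : (⟨m, hm⟩ : Fin (2 * k)) = ⟨2 * (m / 2), by omega⟩ := Fin.ext (by simp; omega)
        rw [e]; exact h.1
    rw [← cgf_zero k]
    congr 1
    refine Ngf_eq (b := 0) (by omega) σ ?_
    rintro ⟨i, hi⟩ ⟨j, hj⟩ hij
    rw [Fin.lt_def, hs i hi, hs j hj]
    simp only [Fin.mk_lt_mk] at hij
    split_ifs <;> simp <;> omega
  · have hs : ∀ (m : ℕ) (hm : m < 2 * k + 1), (τ ⟨m, hm⟩ : ℕ) =
        if m % 2 = 0 then k + m / 2 else k - 1 - m / 2 := by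
      intro m hm
      split_ifs with h2
      · have e : (⟨m, hm⟩ : Fin (2 * k + 1)) = ⟨2 * (m / 2), by omega⟩ :=
          Fin.ext (by simp; omega)
        rw [e]; exact hτev ⟨m / 2, by omega⟩
      · have e : (⟨m, hm⟩ : Fin (2 * k + 1)) = ⟨2 * (m / 2) + 1, by omega⟩ :=
          Fin.ext (by simp; omega)
        rw [e]; exact hτod ⟨m / 2, by omega⟩
    rw [← cgf_one k]
    congr 1
    refine Ngf_eq (b := 1) le_rfl τ ?_
    rintro ⟨i, hi⟩ ⟨j, hj⟩ hij
    rw [Fin.lt_def, hs i hi, hs j hj]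
    simp only [Fin.mk_lt_mk] at hij
    split_ifs <;> simp <;> omega
end
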